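/- Let $\Omega = (a, b)$ with $a < 0 < b$, $T > 0$, $M > 0$, and let $\rho \in C([0,T] \times \bar\Omega)$ with $\rho \ge \alpha > 0$. Suppose $z = (z_1, z_2)$ with $z_1 \in H^{1,2}((0,T)\times(0,b))$, $z_2 \in H^{1,2}((0,T)\times(a,0))$ satisfies: $\rho \partial_{x_0} z_j - \partial^2_{x_1} z_j + b_j \partial_{x_1} z_j + (c_j + K) z_j = g_j$ in the respective subdomains ($j = 1, 2$), $z_1(0,\cdot) = z_2(0,\cdot) = 0$, $z_1(\cdot, b) = z_2(\cdot, a) = 0$, $z_1(\cdot,0) = z_2(\cdot,0)$, and $\partial_{x_1} z_1(\cdot,0) - \partial_{x_1} z_2(\cdot,0) = M \partial_{x_0} z_1(\cdot,0) + M K z_1(\cdot,0) - p(\cdot)$ on $[0,T]$, where $b_j, c_j$ are bounded and $K > 0$. Then there exists $C > 0$ independent of $z$ (but possibly depending on the coefficients, $M$, $K$, $T$) such that $\|z_1\|_{H^{1,2}(Q_+)} + \|z_2\|_{H^{1,2}(Q_-)} + \|z_1(\cdot,0)\|_{H^1(0,T)} \le C (\|p\|_{L^2(0,T)} + \|g_1\|_{L^2(Q_+)}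 + \|g_2\|_{L^2(Q_-)})$. -/

import Mathlib

open Real Set MeasureTheory

lemma ihe_meas_joint (F : ℝ → ℝ → ℝ) (h1 : ∀ x, Differentiable ℝ (fun t => F t x))
    (h2 : ∀ t, ContDiff ℝ 2 (F t)) : Measurable fun q : ℝ × ℝ => F q.1 q.2 := by
  have := measurable_uncurry_of_continuous_of_measurable (u := F)
    (fun x => (h1 x).continuous) (fun t => (h2 t).continuous.measurable)
  exact this

lemma ihe_tendsto_seq : Filter.Tendsto (fun n : ℕ => (1 : ℝ) / ((n : ℝ) + 1)) Filter.atTop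
    (nhdsWithin 0 (Ioi 0)) := by
  rw [tendsto_nhdsWithin_iff]
  exact ⟨tendsto_one_div_add_atTop_nhds_zero_nat, Filter.Eventually.of_forall fun n => by
    simp only [mem_Ioi]; positivity⟩

lemma ihe_deriv_lim (u : ℝ → ℝ) (x : ℝ) (hu : DifferentiableAt ℝ u x) :
    Filter.Tendsto (fun n : ℕ => (u (x + 1 / ((n : ℝ) + 1)) - u x) / (1 / ((n : ℝ) + 1)))
      Filter.atTop (nhds (deriv u x)) := by
  have h := hu.hasDerivAt.tendsto_slope_zero_right.comp ihe_tendsto_seq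
  refine h.congr fun n => ?_
  simp only [Function.comp, smul_eq_mul]
  exact (div_eq_inv_mul _ _).symm

lemma ihe_deriv_lim_left (u : ℝ → ℝ) (x : ℝ) (hu : DifferentiableAt ℝ u x) :
    Filter.Tendsto (fun n : ℕ => (u x - u (x - 1 / ((n : ℝ) + 1))) / (1 / ((n : ℝ) + 1)))
      Filter.atTop (nhds (deriv u x)) := by
  have h0 : HasDerivAt (fun y => - u (2 * x - y)) (deriv u x) x := by
    have h1 : HasDerivAt (fun y => 2 * x - y) (-1) x := by
      simpa using (hasDerivAt_id x).const_sub (2 * x)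
    have h2 : HasDerivAt u (deriv u x) (2 * x - x) := by
      have : 2 * x - x = x := by ring
      rw [this]; exact hu.hasDerivAt
    have h3 := (h2.comp x h1).neg
    rw [mul_neg_one, neg_neg] at h3
    exact h3
  have h := ihe_deriv_lim _ x h0.differentiableAt
  rw [h0.deriv] at h
  refine h.congr fun n => ?_
  have e1 : 2 * x - (x + 1 / ((n : ℝ) + 1)) = x - 1 / ((n : ℝ) + 1) := by ring
  have e2 : 2 * x - x = x := by ring
  rw [e1, e2]; congr 1; ring

lemma ihe_meas_snd (F : ℝ → ℝ → ℝ) (hF : Measurable fun q : ℝ × ℝ => F q.1 q.2)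
    (hd : ∀ t, Differentiable ℝ (F t)) : Measurable fun q : ℝ × ℝ => deriv (F q.1) q.2 := by
  refine measurable_of_tendsto_metrizable (f := fun (n : ℕ) (q : ℝ × ℝ) =>
    (F q.1 (q.2 + 1 / ((n : ℝ) + 1)) - F q.1 q.2) / (1 / ((n : ℝ) + 1))) (fun n => ?_) ?_
  · have : Measurable fun q : ℝ × ℝ => F q.1 (q.2 + 1 / ((n : ℝ) + 1)) :=
      hF.comp (g := fun q : ℝ × ℝ => F q.1 q.2)
        (f := fun q : ℝ × ℝ => (q.1, q.2 + 1 / ((n : ℝ) + 1))) (by fun_prop)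
    exact (this.sub hF).div_const _
  · rw [tendsto_pi_nhds]
    exact fun q => ihe_deriv_lim _ _ (hd q.1 q.2)

lemma ihe_meas_fst (F : ℝ → ℝ → ℝ) (hF : Measurable fun q : ℝ × ℝ => F q.1 q.2)
    (hd : ∀ x, Differentiable ℝ (fun t => F t x)) :
    Measurable fun q : ℝ × ℝ => deriv (fun t => F t q.2) q.1 := by
  have h := ihe_meas_snd (fun x t => F t x)
    (hF.comp (g := fun q : ℝ × ℝ => F q.1 q.2) measurable_swap) hd
  exact h.comp (f := Prod.swap) measurable_swap

lemma ihe_cs {X : Type*} [MeasurableSpace X] (μ : Measure X) [IsFiniteMeasure μ] (f : X → ℝ)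
    (h1 : Integrable f μ) (h2 : Integrable (fun x => f x ^ 2) μ) :
    (∫ x, f x ∂μ) ^ 2 ≤ μ.real univ * ∫ x, f x ^ 2 ∂μ := by
  set V := μ.real univ with hV
  set I := ∫ x, f x ∂μ with hI
  set S := ∫ x, f x ^ 2 ∂μ with hS
  have hV0 : 0 ≤ V := measureReal_nonneg
  have key : 0 ≤ ∫ x, (V ^ 2 * f x ^ 2 - 2 * V * I * f x + I ^ 2) ∂μ :=
    integral_nonneg fun x => by
      have : V ^ 2 * f x ^ 2 - 2 * V * I * f x + I ^ 2 = (V * f x - I) ^ 2 := by ring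
      simp only [Pi.zero_apply]; rw [this]; positivity
  have i1 : Integrable (fun x => V ^ 2 * f x ^ 2 - 2 * V * I * f x) μ :=
    (h2.const_mul _).sub (h1.const_mul _)
  rw [integral_add i1 (integrable_const _),
    integral_sub (h2.const_mul _) (h1.const_mul _), integral_const_mul, integral_const_mul,
    integral_const, ← hI, ← hS, ← hV, smul_eq_mul] at key
  rcases hV0.eq_or_lt with h | h
  · have : μ = 0 := by
      rw [← Measure.measure_univ_eq_zero]
      have := h.symm
      rw [hV, measureReal_eq_zero_iff] at this
      exact this
    simp [hI, hS, this]
  · have : 0 ≤ V * (V * S - I ^ 2) := by nlinarith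
    have := nonneg_of_mul_nonneg_right this h
    linarith

lemma ihe_weak {X : Type*} [MeasurableSpace X] (μ : Measure X) (fn : ℕ → X → ℝ) (f G : X → ℝ)
    (hfn : ∀ n, AEStronglyMeasurable (fn n) μ) (hf : MemLp f 2 μ) (hG : MemLp G 2 μ)
    (hlim : ∀ᵐ x ∂μ, Filter.Tendsto (fun n => fn n x) Filter.atTop (nhds (f x)))
    (hle : ∀ n, ∫⁻ x, ENNReal.ofReal (fn n x ^ 2) ∂μ ≤ ∫⁻ x, ENNReal.ofReal (f x ^ 2) ∂μ) :
    (∀ n, Integrable (fun x => G x * fn n x) μ) ∧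
    ∀ ε > 0, ∀ᶠ n in Filter.atTop, ∫ x, G x * fn n x ∂μ ≤ ∫ x, G x * f x ∂μ + ε := by
  have hf2 : Integrable (fun x => f x ^ 2) μ := hf.integrable_sq
  have hG2 : Integrable (fun x => G x ^ 2) μ := hG.integrable_sq
  have hfn2 : ∀ n, Integrable (fun x => fn n x ^ 2) μ := fun n => by
    refine ⟨(hfn n).pow 2, ?_⟩
    rw [hasFiniteIntegral_iff_ofReal (Filter.Eventually.of_forall fun x => sq_nonneg _)]
    refine (hle n).trans_lt ?_
    have := hf2.2
    rwa [hasFiniteIntegral_iff_ofReal (Filter.Eventually.of_forall fun x => sq_nonneg _)] at this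
  have hfnL : ∀ n, MemLp (fn n) 2 μ := fun n => (memLp_two_iff_integrable_sq (hfn n)).2 (hfn2 n)
  have hGf : Integrable (fun x => G x * f x) μ := hG.integrable_mul hf
  have hGfn : ∀ n, Integrable (fun x => G x * fn n x) μ := fun n => hG.integrable_mul (hfnL n)
  refine ⟨hGfn, fun ε hε => ?_⟩
  by_contra hcon
  rw [Filter.not_eventually] at hcon
  have expand : ∀ g : X → ℝ, MemLp g 2 μ → Integrable (fun x => (g x - G x) ^ 2) μ ∧
      ∫ x, (g x - G x) ^ 2 ∂μ = ∫ x, g x ^ 2 ∂μ + ∫ x, G x ^ 2 ∂μ - 2 * ∫ x, G x * g x ∂μ := by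
    intro g hg
    refine ⟨(hg.sub hG).integrable_sq, ?_⟩
    have i1 : Integrable (fun x => g x ^ 2 + G x ^ 2) μ := hg.integrable_sq.add hG2
    have i2 : Integrable (fun x => 2 * (G x * g x)) μ := (hG.integrable_mul hg).const_mul 2
    rw [← integral_const_mul, ← integral_add hg.integrable_sq hG2,
      ← integral_sub i1 i2]
    refine integral_congr_ae (Filter.Eventually.of_forall fun x => ?_)
    simp only []
    ring
  have hle' : ∀ n, ∫ x, fn n x ^ 2 ∂μ ≤ ∫ x, f x ^ 2 ∂μ := fun n => by
    have := hle n
    rw [← ofReal_integral_eq_lintegral_ofReal (hfn2 n) (Filter.Eventually.of_forall fun x => sq_nonneg _),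
      ← ofReal_integral_eq_lintegral_ofReal hf2 (Filter.Eventually.of_forall fun x => sq_nonneg _)] at this
    exact (ENNReal.ofReal_le_ofReal_iff (integral_nonneg fun x => sq_nonneg _)).1 this
  set c := ∫ x, (f x - G x) ^ 2 ∂μ with hc
  have hfreq : ∃ᶠ n in Filter.atTop, ∫ x, (fn n x - G x) ^ 2 ∂μ ≤ c - 2 * ε := by
    refine hcon.mono fun n hn => ?_
    push Not at hn
    rw [hc, (expand f hf).2, (expand _ (hfnL n)).2]
    linarith [hle' n]
  have hc2 : 0 ≤ c - 2 * ε := by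
    obtain ⟨n, hn⟩ := hfreq.exists
    exact le_trans (integral_nonneg fun x => sq_nonneg _) hn
  have fatou : ∫⁻ x, ENNReal.ofReal ((f x - G x) ^ 2) ∂μ ≤
      Filter.liminf (fun n => ∫⁻ x, ENNReal.ofReal ((fn n x - G x) ^ 2) ∂μ) Filter.atTop := by
    have e : ∫⁻ x, ENNReal.ofReal ((f x - G x) ^ 2) ∂μ =
        ∫⁻ x, Filter.liminf (fun n => ENNReal.ofReal ((fn n x - G x) ^ 2)) Filter.atTop ∂μ := by
      refine lintegral_congr_ae ?_
      filter_upwards [hlim] with x hx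
      exact (ENNReal.tendsto_ofReal ((hx.sub_const _).pow 2)).liminf_eq.symm
    rw [e]
    exact lintegral_liminf_le' fun n => (((hfn n).sub hG.1).pow 2).aemeasurable.ennreal_ofReal
  have h1 : Filter.liminf (fun n => ∫⁻ x, ENNReal.ofReal ((fn n x - G x) ^ 2) ∂μ) Filter.atTop
      ≤ ENNReal.ofReal (c - 2 * ε) := by
    refine Filter.liminf_le_of_frequently_le (hfreq.mono fun n hn => ?_)
    rw [← ofReal_integral_eq_lintegral_ofReal (expand _ (hfnL n)).1
      (Filter.Eventually.of_forall fun x => sq_nonneg _)]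
    exact ENNReal.ofReal_le_ofReal hn
  rw [← ofReal_integral_eq_lintegral_ofReal (expand _ hf).1
      (Filter.Eventually.of_forall fun x => sq_nonneg _)] at fatou
  have := (ENNReal.ofReal_le_ofReal_iff hc2).1 (fatou.trans h1)
  linarith

/-- backward difference quotient (with clamping at time zero) -/
lemma ihe_dq (u : ℝ → ℝ) (T h : ℝ) (hh : 0 < h) (hu : Differentiable ℝ u) :
    ∫⁻ t in Ioo 0 T, ENNReal.ofReal (((u t - u (max (t - h) 0)) / h) ^ 2) ≤
      ∫⁻ t in Ioo 0 T, ENNReal.ofReal (deriv u t ^ 2) := by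
  by_cases hfin : ∫⁻ t in Ioo 0 T, ENNReal.ofReal (deriv u t ^ 2) = ⊤
  · rw [hfin]; exact le_top
  have hmeas : Measurable (deriv u) := measurable_deriv u
  have hsq : IntegrableOn (fun t => deriv u t ^ 2) (Ioo 0 T) := by
    refine ⟨(hmeas.pow_const 2).aestronglyMeasurable, ?_⟩
    rw [hasFiniteIntegral_iff_ofReal (Filter.Eventually.of_forall fun x => sq_nonneg _)]
    exact lt_top_iff_ne_top.2 hfin
  have hint : IntegrableOn (deriv u) (Ioo 0 T) :=
    ((memLp_two_iff_integrable_sq hmeas.aestronglyMeasurable).2 hsq).integrable (by norm_num)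
  set F : ℝ → ENNReal := fun s => (Ioo 0 T).indicator (fun s => ENNReal.ofReal (deriv u s ^ 2)) s
    with hF
  have hFm : Measurable F :=
    ((hmeas.pow_const 2).ennreal_ofReal).indicator measurableSet_Ioo
  -- pointwise
  have hpt : ∀ t ∈ Ioo 0 T, ENNReal.ofReal (((u t - u (max (t - h) 0)) / h) ^ 2) ≤
      ENNReal.ofReal (1 / h) * ∫⁻ s, (Ioo (0:ℝ) h).indicator (fun _ => F (t - s)) s := by
    intro t ht
    set τ := max (t - h) 0 with hτ
    have hτ0 : 0 ≤ τ := le_max_right _ _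
    have hτt : τ ≤ t := max_le (by linarith) ht.1.le
    have hth : t - τ ≤ h := by have := le_max_left (t - h) 0; linarith
    have hsub : Ioo τ t ⊆ Ioo 0 T := Ioo_subset_Ioo hτ0 ht.2.le
    have hftc : ∫ s in Ioo τ t, deriv u s = u t - u τ := by
      rw [← integral_Ioc_eq_integral_Ioo, ← intervalIntegral.integral_of_le hτt]
      refine intervalIntegral.integral_eq_sub_of_hasDerivAt (fun x _ => (hu x).hasDerivAt) ?_
      rw [intervalIntegrable_iff_integrableOn_Ioo_of_le hτt]
      exact hint.mono_set hsub
    have hcs := ihe_cs (volume.restrict (Ioo τ t)) (deriv u) (hint.mono_set hsub) (hsq.mono_set hsub)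
    rw [hftc] at hcs
    have hv : (volume.restrict (Ioo τ t)).real univ = t - τ := by
      simp [measureReal_def, ENNReal.toReal_ofReal (sub_nonneg.2 hτt)]
    rw [hv] at hcs
    have hS0 : 0 ≤ ∫ s in Ioo τ t, deriv u s ^ 2 := integral_nonneg fun _ => sq_nonneg _
    have h2 : ((u t - u τ) / h) ^ 2 ≤ (1 / h) * ∫ s in Ioo τ t, deriv u s ^ 2 := by
      rw [div_pow, div_le_iff₀ (by positivity)]
      have : (1 / h * ∫ s in Ioo τ t, deriv u s ^ 2) * h ^ 2 = h * ∫ s in Ioo τ t, deriv u s ^ 2 := by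
        field_simp
      rw [this]
      exact hcs.trans (mul_le_mul_of_nonneg_right hth hS0)
    refine (ENNReal.ofReal_le_ofReal h2).trans ?_
    rw [ENNReal.ofReal_mul (by positivity)]
    gcongr
    rw [ofReal_integral_eq_lintegral_ofReal (hsq.mono_set hsub)
      (Filter.Eventually.of_forall fun x => sq_nonneg _), ← lintegral_indicator measurableSet_Ioo,
      ← lintegral_sub_left_eq_self _ t]
    refine lintegral_mono fun s => ?_
    by_cases hs : t - s ∈ Ioo τ t
    · have h3 : s ∈ Ioo (0:ℝ) h := ⟨by linarith [hs.2], by linarith [hs.1]⟩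
      rw [indicator_of_mem hs, indicator_of_mem h3]
      simp only [hF]
      rw [indicator_of_mem (hsub hs)]
    · rw [indicator_of_notMem hs]; exact zero_le
  calc _ ≤ ∫⁻ t in Ioo 0 T, ENNReal.ofReal (1 / h) *
        ∫⁻ s, (Ioo (0:ℝ) h).indicator (fun _ => F (t - s)) s :=
        setLIntegral_mono' measurableSet_Ioo hpt
    _ ≤ ∫⁻ t, ENNReal.ofReal (1 / h) *
        ∫⁻ s, (Ioo (0:ℝ) h).indicator (fun _ => F (t - s)) s := setLIntegral_le_lintegral _ _
    _ = ENNReal.ofReal (1 / h) * ∫⁻ t, 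
        ∫⁻ s, (Ioo (0:ℝ) h).indicator (fun _ => F (t - s)) s :=
        lintegral_const_mul' _ _ ENNReal.ofReal_ne_top
    _ = ENNReal.ofReal (1 / h) * ∫⁻ s, 
        ∫⁻ t, (Ioo (0:ℝ) h).indicator (fun _ => F (t - s)) s := by
        congr 1
        refine lintegral_lintegral_swap ?_
        refine Measurable.aemeasurable ?_
        have e : (Function.uncurry fun t s => (Ioo (0:ℝ) h).indicator (fun _ => F (t - s)) s)
          = ((univ : Set ℝ) ×ˢ Ioo (0:ℝ) h).indicator (fun q : ℝ × ℝ => F (q.1 - q.2)) := by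
          ext ⟨t, s⟩
          simp [Function.uncurry, indicator]
        rw [e]
        exact (hFm.comp (by fun_prop)).indicator (MeasurableSet.univ.prod measurableSet_Ioo)
    _ = ENNReal.ofReal (1 / h) * ∫⁻ s, (Ioo (0:ℝ) h).indicator (fun _ => ∫⁻ t, F t) s := by
        congr 1
        refine lintegral_congr fun s => ?_
        by_cases hs : s ∈ Ioo (0:ℝ) h
        · simp only [indicator_of_mem hs]
          exact lintegral_sub_right_eq_self F s
        · simp [indicator_of_notMem hs]
    _ = ∫⁻ t, F t := by
        rw [lintegral_indicator_const measurableSet_Ioo, Real.volume_Ioo, sub_zero, mul_comm (∫⁻ t, F t),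
          ← mul_assoc, ← ENNReal.ofReal_mul (by positivity)]
        simp [hh.ne']
    _ = _ := by rw [hF, lintegral_indicator measurableSet_Ioo]
    

lemma ihe_pt (l r : ℝ) (hlr : l < r) (u v : ℝ → ℝ) (hu : ContDiff ℝ 2 u) (hv : ContDiff ℝ 2 v) :
    (1 / 2) * ((∫ x in Ioo l r, deriv u x ^ 2) - ∫ x in Ioo l r, deriv v x ^ 2) ≤
      deriv u r * (u r - v r) - deriv u l * (u l - v l)
        - ∫ x in Ioo l r, deriv (deriv u) x * (u x - v x) := by
  have hu1 : ContDiff ℝ 1 (deriv u) := by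
    have : ContDiff ℝ (1 + 1) u := by simpa [one_add_one_eq_two] using hu
    exact (contDiff_succ_iff_deriv.1 this).2.2
  have hv1 : Continuous (deriv v) := hv.continuous_deriv (by norm_num)
  have cu1 : Continuous (deriv u) := hu1.continuous
  have cu2 : Continuous (deriv (deriv u)) := hu1.continuous_deriv le_rfl
  have du : Differentiable ℝ u := hu.differentiable (by norm_num)
  have dv : Differentiable ℝ v := hv.differentiable (by norm_num)
  have du1 : Differentiable ℝ (deriv u) := hu1.differentiable (by norm_num)
  have cu := du.continuous
  have cv := dv.continuous
  simp only [← integral_Ioc_eq_integral_Ioo, ← intervalIntegral.integral_of_le hlr.le]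
  have ibp := intervalIntegral.integral_mul_deriv_eq_deriv_mul (a := l) (b := r)
    (u := deriv u) (v := fun x => u x - v x) (u' := deriv (deriv u))
    (v' := fun x => deriv u x - deriv v x)
    (fun x _ => (du1 x).hasDerivAt) (fun x _ => (du x).hasDerivAt.sub (dv x).hasDerivAt)
    (cu2.intervalIntegrable _ _) ((cu1.sub hv1).intervalIntegrable _ _)
  have i1 : IntervalIntegrable (fun x => deriv u x ^ 2) volume l r :=
    (cu1.pow 2).intervalIntegrable _ _
  have i2 : IntervalIntegrable (fun x => deriv v x ^ 2) volume l r :=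
    (hv1.pow 2).intervalIntegrable _ _
  rw [← ibp, ← intervalIntegral.integral_sub i1 i2, ← intervalIntegral.integral_const_mul]
  refine intervalIntegral.integral_mono_on hlr.le
    (Continuous.intervalIntegrable (by fun_prop) _ _)
    (Continuous.intervalIntegrable (by fun_prop) _ _) fun x _ => ?_
  nlinarith [sq_nonneg (deriv u x - deriv v x)]

lemma ihe_poincare (l r x y : ℝ) (hx : x ∈ Icc l r) (hy : y ∈ Icc l r) (u : ℝ → ℝ)
    (hu : ContDiff ℝ 2 u) : (u x - u y) ^ 2 ≤ (r - l) * ∫ s in Ioo l r, deriv u s ^ 2 := by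
  wlog hxy : y ≤ x generalizing x y
  · have := this y x hy hx (le_of_not_ge hxy)
    nlinarith
  have du : Differentiable ℝ u := hu.differentiable (by norm_num)
  have cu1 : Continuous (deriv u) := hu.continuous_deriv (by norm_num)
  have hI : ∀ (f : ℝ → ℝ), Continuous f → ∀ c d : ℝ, IntegrableOn f (Ioo c d) := fun f hf c d =>
    (hf.integrableOn_Icc (a := c) (b := d)).mono_set Ioo_subset_Icc_self
  have hcs := ihe_cs (volume.restrict (Ioo y x)) (deriv u) (hI _ cu1 _ _) (hI _ (cu1.pow 2) _ _)
  have hftc : ∫ s in Ioo y x, deriv u s = u x - u y := by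
    rw [← integral_Ioc_eq_integral_Ioo, ← intervalIntegral.integral_of_le hxy]
    exact intervalIntegral.integral_eq_sub_of_hasDerivAt (fun x _ => (du x).hasDerivAt)
      (cu1.intervalIntegrable _ _)
  have hv : (volume.restrict (Ioo y x)).real univ = x - y := by
    simp [measureReal_def, ENNReal.toReal_ofReal (sub_nonneg.2 hxy)]
  rw [hftc, hv] at hcs
  have hmono : ∫ s in Ioo y x, deriv u s ^ 2 ≤ ∫ s in Ioo l r, deriv u s ^ 2 :=
    setIntegral_mono_set (hI _ (cu1.pow 2) _ _) (Filter.Eventually.of_forall fun _ => sq_nonneg _)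
      (Ioo_subset_Ioo hy.1 hx.2).eventuallyLE
  have h0 : 0 ≤ ∫ s in Ioo y x, deriv u s ^ 2 := integral_nonneg fun _ => sq_nonneg _
  refine hcs.trans (mul_le_mul ?_ hmono h0 ?_) <;> linarith [hx.1, hx.2, hy.1, hy.2]

lemma ihe_shift (E : ℝ → ℝ) (T h lam : ℝ) (hh : 0 < h) (hE0 : E 0 = 0) (hEn : ∀ t, 0 ≤ E t)
    (hE : IntegrableOn (fun t => exp (-lam * t) * E t) (Ioo 0 T)) :
    IntegrableOn (fun t => exp (-lam * t) * E (max (t - h) 0)) (Ioo 0 T) ∧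
    ∫ t in Ioo 0 T, exp (-lam * t) * E (max (t - h) 0) ≤
      exp (-lam * h) * ∫ t in Ioo 0 T, exp (-lam * t) * E t := by
  set F : ℝ → ℝ := (Ioo 0 T).indicator (fun t => exp (-lam * t) * E t) with hF
  have hFi : Integrable F := by rw [hF, integrable_indicator_iff measurableSet_Ioo]; exact hE
  have hFn : ∀ t, 0 ≤ F t := fun t => indicator_nonneg (fun t _ => by have := hEn t; positivity) t
  have hGi : Integrable (fun t => exp (-lam * h) * F (t - h)) :=
    (hFi.comp_sub_right h).const_mul _
  have heq : EqOn (fun t => exp (-lam * h) * F (t - h))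
      (fun t => exp (-lam * t) * E (max (t - h) 0)) (Ioo 0 T) := by
    intro t ht
    simp only
    by_cases hth : 0 < t - h
    · have hm : t - h ∈ Ioo 0 T := ⟨hth, by linarith [ht.2]⟩
      rw [hF, indicator_of_mem hm, max_eq_left hth.le, ← mul_assoc, ← Real.exp_add]
      congr 2; ring
    · have hm : t - h ∉ Ioo 0 T := fun h' => hth h'.1
      rw [hF, indicator_of_notMem hm, max_eq_right (not_lt.1 hth), hE0]; simp
  refine ⟨(hGi.integrableOn).congr_fun heq measurableSet_Ioo, ?_⟩
  rw [← setIntegral_congr_fun measurableSet_Ioo heq]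
  calc _ ≤ ∫ t, exp (-lam * h) * F (t - h) :=
        setIntegral_le_integral hGi (Filter.Eventually.of_forall fun t => by
          have := hFn (t - h); simp only [Pi.zero_apply]; positivity)
    _ = _ := by
        rw [integral_const_mul, integral_sub_right_eq_self F h, hF,
          integral_indicator measurableSet_Ioo]

lemma ihe_comp (S : Set (ℝ × ℝ)) (z : ℝ → ℝ → ℝ)
    (h1 : ∀ x, Differentiable ℝ (fun t => z t x)) (h2 : ∀ t, ContDiff ℝ 2 (z t))
    (hint : IntegrableOn (fun q : ℝ × ℝ => z q.1 q.2 ^ 2 +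
        (deriv (fun t => z t q.2) q.1) ^ 2 + (deriv (z q.1) q.2) ^ 2 +
        (deriv (deriv (z q.1)) q.2) ^ 2) S volume) :
    MemLp (fun q : ℝ × ℝ => z q.1 q.2) 2 (volume.restrict S) ∧
    MemLp (fun q : ℝ × ℝ => deriv (fun t => z t q.2) q.1) 2 (volume.restrict S) ∧
    MemLp (fun q : ℝ × ℝ => deriv (z q.1) q.2) 2 (volume.restrict S) ∧
    MemLp (fun q : ℝ × ℝ => deriv (deriv (z q.1)) q.2) 2 (volume.restrict S) := by
  have m0 := ihe_meas_joint z h1 h2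
  have m1 := ihe_meas_fst z m0 h1
  have m2 := ihe_meas_snd z m0 (fun t => (h2 t).differentiable (by norm_num))
  have m3 := ihe_meas_snd (fun t => deriv (z t)) m2 (fun t => by
    have : ContDiff ℝ (1 + 1) (z t) := by simpa [one_add_one_eq_two] using h2 t
    exact (contDiff_succ_iff_deriv.1 this).2.2.differentiable (by norm_num))
  have key : ∀ f : ℝ × ℝ → ℝ, Measurable f → (∀ q : ℝ × ℝ, f q ^ 2 ≤ z q.1 q.2 ^ 2 +
        (deriv (fun t => z t q.2) q.1) ^ 2 + (deriv (z q.1) q.2) ^ 2 +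
        (deriv (deriv (z q.1)) q.2) ^ 2) → MemLp f 2 (volume.restrict S) := by
    intro f hf hle
    rw [memLp_two_iff_integrable_sq hf.aestronglyMeasurable]
    refine hint.mono' (hf.pow_const 2).aestronglyMeasurable (Filter.Eventually.of_forall fun q => ?_)
    rw [Real.norm_of_nonneg (sq_nonneg _)]; exact hle q
  refine ⟨key _ m0 fun q => ?_, key _ m1 fun q => ?_, key _ m2 fun q => ?_, key _ m3 fun q => ?_⟩
  · linarith [sq_nonneg (deriv (fun t => z t q.2) q.1), sq_nonneg (deriv (z q.1) q.2),
      sq_nonneg (deriv (deriv (z q.1)) q.2)]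
  · linarith [sq_nonneg (z q.1 q.2), sq_nonneg (deriv (z q.1) q.2),
      sq_nonneg (deriv (deriv (z q.1)) q.2)]
  · linarith [sq_nonneg (z q.1 q.2), sq_nonneg (deriv (fun t => z t q.2) q.1),
      sq_nonneg (deriv (deriv (z q.1)) q.2)]
  · linarith [sq_nonneg (z q.1 q.2), sq_nonneg (deriv (fun t => z t q.2) q.1),
      sq_nonneg (deriv (z q.1) q.2)]

lemma ihe_dq_lim (u : ℝ → ℝ) (t : ℝ) (ht : 0 < t) (hu : Differentiable ℝ u) :
    Filter.Tendsto (fun n : ℕ => (u t - u (max (t - 1 / ((n : ℝ) + 1)) 0)) / (1 / ((n : ℝ) + 1)))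
      Filter.atTop (nhds (deriv u t)) := by
  refine (ihe_deriv_lim_left u t (hu t)).congr' ?_
  have : ∀ᶠ n : ℕ in Filter.atTop, (1 : ℝ) / ((n : ℝ) + 1) < t :=
    tendsto_one_div_add_atTop_nhds_zero_nat.eventually (gt_mem_nhds ht)
  filter_upwards [this] with n hn
  rw [max_eq_left (by linarith)]

/-- bounded weights preserve L2 -/
lemma ihe_wmem {X : Type*} [MeasurableSpace X] (μ : Measure X) (w f : X → ℝ) (hw : Measurable w)
    (hwb : ∀ᵐ x ∂μ, |w x| ≤ 1) (hf : MemLp f 2 μ) : MemLp (fun x => w x * f x) 2 μ := by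
  refine hf.mono (hw.aestronglyMeasurable.mul hf.1) ?_
  filter_upwards [hwb] with x hx
  rw [norm_mul, Real.norm_eq_abs (w x)]
  exact mul_le_of_le_one_left (norm_nonneg _) hx

lemma ihe_bulk (l r T lam : ℝ) (hlam : 0 < lam) (z : ℝ → ℝ → ℝ)
    (h1 : ∀ x, Differentiable ℝ (fun t => z t x)) (h2 : ∀ t, ContDiff ℝ 2 (z t))
    (hint : IntegrableOn (fun q : ℝ × ℝ => z q.1 q.2 ^ 2 +
        (deriv (fun t => z t q.2) q.1) ^ 2 + (deriv (z q.1) q.2) ^ 2 +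
        (deriv (deriv (z q.1)) q.2) ^ 2) (Ioo 0 T ×ˢ Ioo l r) volume) :
    (∀ n : ℕ, IntegrableOn (fun q : ℝ × ℝ => exp (-lam * q.1) * (-deriv (deriv (z q.1)) q.2) *
      ((z q.1 q.2 - z (max (q.1 - 1 / ((n : ℝ) + 1)) 0) q.2) / (1 / ((n : ℝ) + 1))))
      (Ioo 0 T ×ˢ Ioo l r)) ∧
    ∀ ε > 0, ∀ᶠ n : ℕ in Filter.atTop,
      ∫ q in Ioo 0 T ×ˢ Ioo l r, exp (-lam * q.1) * (-deriv (deriv (z q.1)) q.2) *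
      ((z q.1 q.2 - z (max (q.1 - 1 / ((n : ℝ) + 1)) 0) q.2) / (1 / ((n : ℝ) + 1))) ≤
      (∫ q in Ioo 0 T ×ˢ Ioo l r, exp (-lam * q.1) * (-deriv (deriv (z q.1)) q.2) *
        deriv (fun t => z t q.2) q.1) + ε := by
  obtain ⟨L0, L1, L2, L3⟩ := ihe_comp _ z h1 h2 hint
  have m0 := ihe_meas_joint z h1 h2
  have hS : MeasurableSet (Ioo 0 T ×ˢ Ioo l r) := measurableSet_Ioo.prod measurableSet_Ioo
  have mD : ∀ n : ℕ, Measurable (fun q : ℝ × ℝ =>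
      (z q.1 q.2 - z (max (q.1 - 1 / ((n : ℝ) + 1)) 0) q.2) / (1 / ((n : ℝ) + 1))) := fun n => by
    have : Measurable fun q : ℝ × ℝ => z (max (q.1 - 1 / ((n : ℝ) + 1)) 0) q.2 :=
      m0.comp (g := fun q : ℝ × ℝ => z q.1 q.2)
        (f := fun q : ℝ × ℝ => (max (q.1 - 1 / ((n : ℝ) + 1)) 0, q.2)) (by fun_prop)
    exact (m0.sub this).div_const _
  refine ihe_weak (volume.restrict (Ioo 0 T ×ˢ Ioo l r))
    (fun n q => (z q.1 q.2 - z (max (q.1 - 1 / ((n : ℝ) + 1)) 0) q.2) / (1 / ((n : ℝ) + 1)))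
    (fun q => deriv (fun t => z t q.2) q.1)
    (fun q => exp (-lam * q.1) * (-deriv (deriv (z q.1)) q.2))
    (fun n => (mD n).aestronglyMeasurable) L1 ?_ ?_ ?_
  · refine ihe_wmem _ (fun q => exp (-lam * q.1)) _ (by fun_prop) ?_ L3.neg
    refine (ae_restrict_iff' hS).2 (Filter.Eventually.of_forall fun q hq => ?_)
    rw [abs_of_pos (exp_pos _), Real.exp_le_one_iff]
    have := hq.1.1
    nlinarith
  · refine (ae_restrict_iff' hS).2 (Filter.Eventually.of_forall fun q hq => ?_)
    exact ihe_dq_lim (fun t => z t q.2) q.1 hq.1.1 (h1 q.2)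
  · intro n
    have m1 := ihe_meas_fst z m0 h1
    rw [Measure.volume_eq_prod, ← Measure.prod_restrict,
      lintegral_prod_symm _ ((mD n).pow_const 2).ennreal_ofReal.aemeasurable,
      lintegral_prod_symm _ (m1.pow_const 2).ennreal_ofReal.aemeasurable]
    exact lintegral_mono fun x => ihe_dq (fun t => z t x) T _ (by positivity) (h1 x)

lemma ihe_trace (T lam : ℝ) (hlam : 0 < lam) (u G : ℝ → ℝ) (hu : Differentiable ℝ u)
    (hu' : MemLp (deriv u) 2 (volume.restrict (Ioo 0 T)))
    (hG : MemLp G 2 (volume.restrict (Ioo 0 T))) :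
    (∀ n : ℕ, IntegrableOn (fun t : ℝ => exp (-lam * t) * (-G t) *
      ((u t - u (max (t - 1 / ((n : ℝ) + 1)) 0)) / (1 / ((n : ℝ) + 1)))) (Ioo 0 T)) ∧
    ∀ ε > 0, ∀ᶠ n : ℕ in Filter.atTop,
      ∫ t in Ioo 0 T, exp (-lam * t) * (-G t) *
      ((u t - u (max (t - 1 / ((n : ℝ) + 1)) 0)) / (1 / ((n : ℝ) + 1))) ≤
      (∫ t in Ioo 0 T, exp (-lam * t) * (-G t) * deriv u t) + ε := by
  have m0 := hu.continuous
  refine ihe_weak (volume.restrict (Ioo 0 T))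
    (fun n t => (u t - u (max (t - 1 / ((n : ℝ) + 1)) 0)) / (1 / ((n : ℝ) + 1)))
    (deriv u) (fun t => exp (-lam * t) * (-G t))
    (fun n => Continuous.aestronglyMeasurable (by fun_prop)) hu' ?_ ?_ ?_
  · refine ihe_wmem _ (fun t => exp (-lam * t)) _ (by fun_prop) ?_ hG.neg
    refine (ae_restrict_iff' measurableSet_Ioo).2 (Filter.Eventually.of_forall fun t ht => ?_)
    rw [abs_of_pos (exp_pos _), Real.exp_le_one_iff]
    have := ht.1
    nlinarith
  · refine (ae_restrict_iff' measurableSet_Ioo).2 (Filter.Eventually.of_forall fun t ht => ?_)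
    exact ihe_dq_lim u t ht.1 hu
  · intro n
    exact ihe_dq u T _ (by positivity) hu

lemma ihe_wE (l r T lam : ℝ) (hlam : 0 < lam) (f : ℝ → ℝ → ℝ)
    (hf : MemLp (fun q : ℝ × ℝ => f q.1 q.2) 2 (volume.restrict (Ioo 0 T ×ˢ Ioo l r))) :
    IntegrableOn (fun q : ℝ × ℝ => exp (-lam * q.1) * f q.1 q.2 ^ 2) (Ioo 0 T ×ˢ Ioo l r) ∧
    IntegrableOn (fun t => exp (-lam * t) * ∫ x in Ioo l r, f t x ^ 2) (Ioo 0 T) ∧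
    ∫ q in Ioo 0 T ×ˢ Ioo l r, exp (-lam * q.1) * f q.1 q.2 ^ 2 =
      ∫ t in Ioo 0 T, exp (-lam * t) * ∫ x in Ioo l r, f t x ^ 2 := by
  have hS : MeasurableSet (Ioo 0 T ×ˢ Ioo l r) := measurableSet_Ioo.prod measurableSet_Ioo
  have hi : IntegrableOn (fun q : ℝ × ℝ => exp (-lam * q.1) * f q.1 q.2 ^ 2)
      (Ioo 0 T ×ˢ Ioo l r) := by
    have hw := ihe_wmem _ (fun q : ℝ × ℝ => exp (-lam * q.1)) _ (by fun_prop) (by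
      refine (ae_restrict_iff' hS).2 (Filter.Eventually.of_forall fun q hq => ?_)
      rw [abs_of_pos (exp_pos _), Real.exp_le_one_iff]
      have := hq.1.1
      nlinarith) hf
    refine (hw.integrable_mul hf).congr (Filter.Eventually.of_forall fun q => ?_)
    simp only [Pi.mul_apply]; ring
  refine ⟨hi, ?_, ?_⟩
  · have h := hi
    rw [IntegrableOn, Measure.volume_eq_prod, ← Measure.prod_restrict] at h
    have h' := h.integral_prod_left
    refine h'.congr (Filter.Eventually.of_forall fun t => ?_)
    simp only [integral_const_mul]
  · rw [Measure.volume_eq_prod, setIntegral_prod _ (by rw [← Measure.volume_eq_prod]; exact hi)]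
    simp only [integral_const_mul]

lemma ihe_energy (a b T lam : ℝ) (ha : a < 0) (hb : 0 < b) (hlam : 0 < lam)
    (z₁ z₂ : ℝ → ℝ → ℝ)
    (h11 : ∀ x, Differentiable ℝ (fun t => z₁ t x)) (h21 : ∀ t, ContDiff ℝ 2 (z₁ t))
    (h12 : ∀ x, Differentiable ℝ (fun t => z₂ t x)) (h22 : ∀ t, ContDiff ℝ 2 (z₂ t))
    (hint1 : IntegrableOn (fun q : ℝ × ℝ => z₁ q.1 q.2 ^ 2 +
        (deriv (fun t => z₁ t q.2) q.1) ^ 2 + (deriv (z₁ q.1) q.2) ^ 2 +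
        (deriv (deriv (z₁ q.1)) q.2) ^ 2) (Ioo 0 T ×ˢ Ioo 0 b) volume)
    (hint2 : IntegrableOn (fun q : ℝ × ℝ => z₂ q.1 q.2 ^ 2 +
        (deriv (fun t => z₂ t q.2) q.1) ^ 2 + (deriv (z₂ q.1) q.2) ^ 2 +
        (deriv (deriv (z₂ q.1)) q.2) ^ 2) (Ioo 0 T ×ˢ Ioo a 0) volume)
    (hz10 : ∀ x, z₁ 0 x = 0) (hz20 : ∀ x, z₂ 0 x = 0)
    (hz1b : ∀ t ∈ Icc 0 T, z₁ t b = 0) (hz2a : ∀ t ∈ Icc 0 T, z₂ t a = 0)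
    (hif : ∀ t ∈ Icc 0 T, z₁ t 0 = z₂ t 0)
    (hu' : MemLp (deriv fun t => z₁ t 0) 2 (volume.restrict (Ioo 0 T)))
    (hG : MemLp (fun t => deriv (z₁ t) 0 - deriv (z₂ t) 0) 2 (volume.restrict (Ioo 0 T))) :
    (lam / 4) * ((∫ t in Ioo 0 T, exp (-lam * t) * ∫ x in Ioo 0 b, deriv (z₁ t) x ^ 2) +
        ∫ t in Ioo 0 T, exp (-lam * t) * ∫ x in Ioo a 0, deriv (z₂ t) x ^ 2) ≤
      (∫ t in Ioo 0 T, exp (-lam * t) * (-(deriv (z₁ t) 0 - deriv (z₂ t) 0)) *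
        deriv (fun t => z₁ t 0) t) +
      (∫ q in Ioo 0 T ×ˢ Ioo 0 b, exp (-lam * q.1) * (-deriv (deriv (z₁ q.1)) q.2) *
        deriv (fun t => z₁ t q.2) q.1) +
      (∫ q in Ioo 0 T ×ˢ Ioo a 0, exp (-lam * q.1) * (-deriv (deriv (z₂ q.1)) q.2) *
        deriv (fun t => z₂ t q.2) q.1) := by
  obtain ⟨-, -, L12, -⟩ := ihe_comp _ z₁ h11 h21 hint1
  obtain ⟨-, -, L22, -⟩ := ihe_comp _ z₂ h12 h22 hint2
  obtain ⟨-, wE1, -⟩ := ihe_wE 0 b T lam hlam (fun t x => deriv (z₁ t) x) L12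
  obtain ⟨-, wE2, -⟩ := ihe_wE a 0 T lam hlam (fun t x => deriv (z₂ t) x) L22
  obtain ⟨B1i, B1⟩ := ihe_bulk 0 b T lam hlam z₁ h11 h21 hint1
  obtain ⟨B2i, B2⟩ := ihe_bulk a 0 T lam hlam z₂ h12 h22 hint2
  obtain ⟨Tri, Tr⟩ := ihe_trace T lam hlam (fun t => z₁ t 0) _ (h11 0) hu' hG
  set E1 : ℝ → ℝ := fun t => ∫ x in Ioo 0 b, deriv (z₁ t) x ^ 2 with hE1
  set E2 : ℝ → ℝ := fun t => ∫ x in Ioo a 0, deriv (z₂ t) x ^ 2 with hE2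
  have E1n : ∀ t, 0 ≤ E1 t := fun t => integral_nonneg fun _ => sq_nonneg _
  have E2n : ∀ t, 0 ≤ E2 t := fun t => integral_nonneg fun _ => sq_nonneg _
  have E10 : E1 0 = 0 := by
    have : z₁ 0 = fun _ => 0 := funext hz10
    simp [hE1, this]
  have E20 : E2 0 = 0 := by
    have : z₂ 0 = fun _ => 0 := funext hz20
    simp [hE2, this]
  set Y1 := ∫ t in Ioo 0 T, exp (-lam * t) * E1 t with hY1
  set Y2 := ∫ t in Ioo 0 T, exp (-lam * t) * E2 t with hY2
  have Y1n : 0 ≤ Y1 := integral_nonneg fun t => by have := E1n t; simp only [Pi.zero_apply]; positivity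
  have Y2n : 0 ≤ Y2 := integral_nonneg fun t => by have := E2n t; simp only [Pi.zero_apply]; positivity
  refine le_of_forall_pos_le_add fun ε hε => ?_
  have hsm : ∀ᶠ n : ℕ in Filter.atTop, (1 : ℝ) / ((n : ℝ) + 1) < 1 / lam :=
    tendsto_one_div_add_atTop_nhds_zero_nat.eventually (gt_mem_nhds (by positivity))
  obtain ⟨n, hn1, hn2, hn3, hn4⟩ := ((Tr (ε / 3) (by positivity)).and
    ((B1 (ε / 3) (by positivity)).and ((B2 (ε / 3) (by positivity)).and hsm))).exists
  specialize B1i n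
  specialize B2i n
  specialize Tri n
  set h : ℝ := 1 / ((n : ℝ) + 1) with hh
  have hpos : 0 < h := by positivity
  obtain ⟨S1i, S1⟩ := ihe_shift E1 T h lam hpos E10 E1n wE1
  obtain ⟨S2i, S2⟩ := ihe_shift E2 T h lam hpos E20 E2n wE2
  -- Fubini for the bulk terms
  have fub : ∀ (l r : ℝ) (z : ℝ → ℝ → ℝ),
      IntegrableOn (fun q : ℝ × ℝ => exp (-lam * q.1) * (-deriv (deriv (z q.1)) q.2) *
        ((z q.1 q.2 - z (max (q.1 - h) 0) q.2) / h)) (Ioo 0 T ×ˢ Ioo l r) →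
      IntegrableOn (fun t => exp (-lam * t) / h *
        (-∫ x in Ioo l r, deriv (deriv (z t)) x * (z t x - z (max (t - h) 0) x))) (Ioo 0 T) ∧
      ∫ q in Ioo 0 T ×ˢ Ioo l r, exp (-lam * q.1) * (-deriv (deriv (z q.1)) q.2) *
        ((z q.1 q.2 - z (max (q.1 - h) 0) q.2) / h) =
      ∫ t in Ioo 0 T, exp (-lam * t) / h *
        (-∫ x in Ioo l r, deriv (deriv (z t)) x * (z t x - z (max (t - h) 0) x)) := by
    intro l r z hi
    have e : ∀ t, ∫ x in Ioo l r, exp (-lam * t) * (-deriv (deriv (z t)) x) *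
        ((z t x - z (max (t - h) 0) x) / h) = exp (-lam * t) / h *
        (-∫ x in Ioo l r, deriv (deriv (z t)) x * (z t x - z (max (t - h) 0) x)) := by
      intro t
      rw [← integral_neg, ← integral_const_mul]
      refine integral_congr_ae (Filter.Eventually.of_forall fun x => ?_)
      simp only
      ring
    constructor
    · have h0 := hi
      rw [IntegrableOn, Measure.volume_eq_prod, ← Measure.prod_restrict] at h0
      exact h0.integral_prod_left.congr (Filter.Eventually.of_forall e)
    · rw [Measure.volume_eq_prod, setIntegral_prod _ (by rw [← Measure.volume_eq_prod]; exact hi)]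
      exact integral_congr_ae (Filter.Eventually.of_forall e)
  obtain ⟨F1i, F1⟩ := fub 0 b z₁ B1i
  obtain ⟨F2i, F2⟩ := fub a 0 z₂ B2i
  rw [F1] at hn2
  rw [F2] at hn3
  -- the pointwise in time inequality
  have hpt : ∀ t ∈ Ioo 0 T, (1 / (2 * h)) * ((exp (-lam * t) * E1 t -
      exp (-lam * t) * E1 (max (t - h) 0)) + (exp (-lam * t) * E2 t -
      exp (-lam * t) * E2 (max (t - h) 0))) ≤
      (exp (-lam * t) * (-(deriv (z₁ t) 0 - deriv (z₂ t) 0)) *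
      ((z₁ t 0 - z₁ (max (t - h) 0) 0) / h) + exp (-lam * t) / h *
        (-∫ x in Ioo 0 b, deriv (deriv (z₁ t)) x * (z₁ t x - z₁ (max (t - h) 0) x))) +
      exp (-lam * t) / h *
        (-∫ x in Ioo a 0, deriv (deriv (z₂ t)) x * (z₂ t x - z₂ (max (t - h) 0) x)) := by
    intro t ht
    set τ := max (t - h) 0 with hτ
    have ht' : t ∈ Icc 0 T := ⟨ht.1.le, ht.2.le⟩
    have hτ' : τ ∈ Icc 0 T := ⟨le_max_right _ _, max_le (by linarith [ht.2]) (by linarith [ht.1, ht.2])⟩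
    have p1 := ihe_pt 0 b hb (z₁ t) (z₁ τ) (h21 t) (h21 τ)
    have p2 := ihe_pt a 0 ha (z₂ t) (z₂ τ) (h22 t) (h22 τ)
    rw [hz1b t ht', hz1b τ hτ'] at p1
    rw [hz2a t ht', hz2a τ hτ', ← hif t ht', ← hif τ hτ'] at p2
    have hk : 0 ≤ exp (-lam * t) / h := by positivity
    have p3 := mul_le_mul_of_nonneg_left (add_le_add p1 p2) hk
    have e1 : E1 t = ∫ x in Ioo 0 b, deriv (z₁ t) x ^ 2 := rfl
    have e2 : E2 t = ∫ x in Ioo a 0, deriv (z₂ t) x ^ 2 := rfl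
    have e3 : E1 τ = ∫ x in Ioo 0 b, deriv (z₁ τ) x ^ 2 := rfl
    have e4 : E2 τ = ∫ x in Ioo a 0, deriv (z₂ τ) x ^ 2 := rfl
    rw [← e1, ← e2, ← e3, ← e4] at p3
    refine le_trans (le_of_eq ?_) (p3.trans (le_of_eq ?_))
    · field_simp
    · ring
  have hI := setIntegral_mono_on ((((wE1.sub S1i).add (wE2.sub S2i))).const_mul (1 / (2 * h)))
    ((Tri.add F1i).add F2i) measurableSet_Ioo hpt
  have i12 : IntegrableOn (fun t => exp (-lam * t) * (-(deriv (z₁ t) 0 - deriv (z₂ t) 0)) *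
      ((z₁ t 0 - z₁ (max (t - h) 0) 0) / h) + exp (-lam * t) / h *
        (-∫ x in Ioo 0 b, deriv (deriv (z₁ t)) x * (z₁ t x - z₁ (max (t - h) 0) x))) (Ioo 0 T) :=
    Tri.add F1i
  have d1 : IntegrableOn (fun t => exp (-lam * t) * E1 t -
      exp (-lam * t) * E1 (max (t - h) 0)) (Ioo 0 T) := wE1.sub S1i
  have d2 : IntegrableOn (fun t => exp (-lam * t) * E2 t -
      exp (-lam * t) * E2 (max (t - h) 0)) (Ioo 0 T) := wE2.sub S2i
  simp only [Pi.add_apply, Pi.sub_apply] at hI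
  rw [integral_add i12 F2i, integral_add Tri F1i, integral_const_mul, integral_add d1 d2,
    integral_sub wE1 S1i, integral_sub wE2 S2i, ← hY1, ← hY2] at hI
  -- exponential bound
  have hexp : exp (-lam * h) ≤ 1 - lam * h / 2 := by
    have hx0 : 0 < lam * h := by positivity
    have hx1 : lam * h < 1 := by
      rw [lt_div_iff₀ hlam] at hn4; linarith
    have h1 : lam * h + 1 ≤ exp (lam * h) := Real.add_one_le_exp _
    have h2 : exp (-lam * h) * exp (lam * h) = 1 := by rw [← Real.exp_add]; simp
    have h3 : 0 < exp (-lam * h) := exp_pos _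
    have h4 : exp (-lam * h) * (lam * h + 1) ≤ 1 := by nlinarith
    by_contra hc
    push Not at hc
    have : (1 - lam * h / 2) * (lam * h + 1) < exp (-lam * h) * (lam * h + 1) :=
      mul_lt_mul_of_pos_right hc (by linarith)
    nlinarith
  have k1 : lam * h / 2 * (Y1 + Y2) ≤ (Y1 - ∫ t in Ioo 0 T, exp (-lam * t) * E1 (max (t - h) 0)) +
      (Y2 - ∫ t in Ioo 0 T, exp (-lam * t) * E2 (max (t - h) 0)) := by
    have := mul_le_mul_of_nonneg_right hexp (add_nonneg Y1n Y2n)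
    nlinarith
  have k2 := mul_le_mul_of_nonneg_left k1 (by positivity : 0 ≤ 1 / (2 * h))
  have k3 : 1 / (2 * h) * (lam * h / 2 * (Y1 + Y2)) = lam / 4 * (Y1 + Y2) := by
    field_simp; ring
  rw [k3] at k2
  linarith

lemma ihe_z2 (l r T lam : ℝ) (hlam : 0 < lam) (hlr : l < r) (z : ℝ → ℝ → ℝ)
    (h2 : ∀ t, ContDiff ℝ 2 (z t))
    (x0 : ℝ) (hx0 : x0 ∈ Icc l r) (hzx0 : ∀ t ∈ Icc 0 T, z t x0 = 0)
    (L0 : MemLp (fun q : ℝ × ℝ => z q.1 q.2) 2 (volume.restrict (Ioo 0 T ×ˢ Ioo l r)))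
    (L2 : MemLp (fun q : ℝ × ℝ => deriv (z q.1) q.2) 2 (volume.restrict (Ioo 0 T ×ˢ Ioo l r))) :
    ∫ q in Ioo 0 T ×ˢ Ioo l r, exp (-lam * q.1) * z q.1 q.2 ^ 2 ≤
      (r - l) ^ 2 * ∫ t in Ioo 0 T, exp (-lam * t) * ∫ x in Ioo l r, deriv (z t) x ^ 2 := by
  obtain ⟨-, i0, e0⟩ := ihe_wE l r T lam hlam z L0
  obtain ⟨-, i2, -⟩ := ihe_wE l r T lam hlam (fun t x => deriv (z t) x) L2
  rw [e0, ← integral_const_mul]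
  refine setIntegral_mono_on i0 (i2.const_mul _) measurableSet_Ioo fun t ht => ?_
  have hb : ∫ x in Ioo l r, z t x ^ 2 ≤ (r - l) * ((r - l) * ∫ s in Ioo l r, deriv (z t) s ^ 2) := by
    have hc : ∫ _ in Ioo l r, ((r - l) * ∫ s in Ioo l r, deriv (z t) s ^ 2) =
        (r - l) * ((r - l) * ∫ s in Ioo l r, deriv (z t) s ^ 2) := by
      rw [setIntegral_const, smul_eq_mul, measureReal_def, Real.volume_Ioo,
        ENNReal.toReal_ofReal (by linarith)]
    rw [← hc]
    refine setIntegral_mono_on ?_ (integrableOn_const (by simp)) measurableSet_Ioo fun x hx => ?_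
    · exact (((h2 t).continuous.pow 2).integrableOn_Icc (a := l) (b := r)).mono_set
        Ioo_subset_Icc_self
    · have := ihe_poincare l r x x0 ⟨hx.1.le, hx.2.le⟩ hx0 (z t) (h2 t)
      rwa [hzx0 t ⟨ht.1.le, ht.2.le⟩, sub_zero] at this
  have := mul_le_mul_of_nonneg_left hb (exp_pos (-lam * t)).le
  refine this.trans (le_of_eq ?_)
  ring

set_option maxHeartbeats 1000000 in
lemma ihe_side (l r T lam K α B R : ℝ) (hlam : 0 < lam) (hlr : l < r) (hα : 0 < α)
    (hK : 0 < K)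
    (ρ bb cc z g : ℝ → ℝ → ℝ)
    (hρpos : ∀ x₀ x₁, α ≤ ρ x₀ x₁)
    (hρR : ∀ t ∈ Icc 0 T, ∀ x ∈ Icc l r, ρ t x ≤ R)
    (hbb : ∀ t x, |bb t x| ≤ B) (hcc : ∀ t x, |cc t x| ≤ B)
    (h1 : ∀ x, Differentiable ℝ (fun t => z t x)) (h2 : ∀ t, ContDiff ℝ 2 (z t))
    (hint : IntegrableOn (fun q : ℝ × ℝ => z q.1 q.2 ^ 2 +
        (deriv (fun t => z t q.2) q.1) ^ 2 + (deriv (z q.1) q.2) ^ 2 +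
        (deriv (deriv (z q.1)) q.2) ^ 2) (Ioo 0 T ×ˢ Ioo l r) volume)
    (hg : IntegrableOn (fun q : ℝ × ℝ => g q.1 q.2 ^ 2) (Ioo 0 T ×ˢ Ioo l r) volume)
    (heq : ∀ x₀ ∈ Ioo 0 T, ∀ x₁ ∈ Ioo l r,
        ρ x₀ x₁ * deriv (fun t => z t x₁) x₀ - deriv (deriv (z x₀)) x₁ +
          bb x₀ x₁ * deriv (z x₀) x₁ + (cc x₀ x₁ + K) * z x₀ x₁ = g x₀ x₁)
    (x0 : ℝ) (hx0 : x0 ∈ Icc l r) (hzx0 : ∀ t ∈ Icc 0 T, z t x0 = 0) :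
    (∫ q in Ioo 0 T ×ˢ Ioo l r, exp (-lam * q.1) * (-deriv (deriv (z q.1)) q.2) *
        deriv (fun t => z t q.2) q.1) ≤
      -(α / 2) * (∫ q in Ioo 0 T ×ˢ Ioo l r, exp (-lam * q.1) * deriv (fun t => z t q.2) q.1 ^ 2) +
      (3 / (2 * α)) * (∫ q in Ioo 0 T ×ˢ Ioo l r, g q.1 q.2 ^ 2) +
      (3 / (2 * α)) * (B ^ 2 + (B + K) ^ 2 * (r - l) ^ 2) *
        ∫ t in Ioo 0 T, exp (-lam * t) * ∫ x in Ioo l r, deriv (z t) x ^ 2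
    ∧ 
    (∫ q in Ioo 0 T ×ˢ Ioo l r, (z q.1 q.2 ^ 2 +
        (deriv (fun t => z t q.2) q.1) ^ 2 + (deriv (z q.1) q.2) ^ 2 +
        (deriv (deriv (z q.1)) q.2) ^ 2)) ≤
      exp (lam * T) * (1 + 4 * R ^ 2) *
        (∫ q in Ioo 0 T ×ˢ Ioo l r, exp (-lam * q.1) * deriv (fun t => z t q.2) q.1 ^ 2) +
      4 * (∫ q in Ioo 0 T ×ˢ Ioo l r, g q.1 q.2 ^ 2) +
      exp (lam * T) * ((1 + 4 * B ^ 2) + (1 + 4 * (B + K) ^ 2) * (r - l) ^ 2) *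
        ∫ t in Ioo 0 T, exp (-lam * t) * ∫ x in Ioo l r, deriv (z t) x ^ 2 := by
  have hB : 0 ≤ B := (abs_nonneg _).trans (hbb 0 0)
  have hS : MeasurableSet (Ioo 0 T ×ˢ Ioo l r) := measurableSet_Ioo.prod measurableSet_Ioo
  obtain ⟨L0, L1, L2, L3⟩ := ihe_comp _ z h1 h2 hint
  have hz2 := ihe_z2 l r T lam hlam hlr z h2 x0 hx0 hzx0 L0 L2
  obtain ⟨i0, -, -⟩ := ihe_wE l r T lam hlam z L0
  obtain ⟨i1, -, -⟩ := ihe_wE l r T lam hlam (fun t x => deriv (fun t => z t x) t) L1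
  obtain ⟨i2, -, e2⟩ := ihe_wE l r T lam hlam (fun t x => deriv (z t) x) L2
  rw [← e2] at hz2 ⊢
  set A := ∫ q in Ioo 0 T ×ˢ Ioo l r, exp (-lam * q.1) * deriv (fun t => z t q.2) q.1 ^ 2 with hA
  set Y := ∫ q in Ioo 0 T ×ˢ Ioo l r, exp (-lam * q.1) * deriv (z q.1) q.2 ^ 2 with hY
  set W := ∫ q in Ioo 0 T ×ˢ Ioo l r, exp (-lam * q.1) * z q.1 q.2 ^ 2 with hW
  set Γ := ∫ q in Ioo 0 T ×ˢ Ioo l r, g q.1 q.2 ^ 2 with hΓ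
  -- generic linear combination
  have comb : ∀ c1 c2 c3 c4 : ℝ, IntegrableOn (fun q : ℝ × ℝ =>
        c1 * (exp (-lam * q.1) * deriv (fun t => z t q.2) q.1 ^ 2) + c2 * g q.1 q.2 ^ 2 +
        c3 * (exp (-lam * q.1) * deriv (z q.1) q.2 ^ 2) + c4 * (exp (-lam * q.1) * z q.1 q.2 ^ 2))
        (Ioo 0 T ×ˢ Ioo l r) ∧
      ∫ q in Ioo 0 T ×ˢ Ioo l r,
        (c1 * (exp (-lam * q.1) * deriv (fun t => z t q.2) q.1 ^ 2) + c2 * g q.1 q.2 ^ 2 +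
        c3 * (exp (-lam * q.1) * deriv (z q.1) q.2 ^ 2) + c4 * (exp (-lam * q.1) * z q.1 q.2 ^ 2))
        = c1 * A + c2 * Γ + c3 * Y + c4 * W := by
    intro c1 c2 c3 c4
    have j1 : IntegrableOn (fun q : ℝ × ℝ =>
        c1 * (exp (-lam * q.1) * deriv (fun t => z t q.2) q.1 ^ 2) + c2 * g q.1 q.2 ^ 2)
        (Ioo 0 T ×ˢ Ioo l r) := (i1.const_mul c1).add (hg.const_mul c2)
    have j2 : IntegrableOn (fun q : ℝ × ℝ =>
        c1 * (exp (-lam * q.1) * deriv (fun t => z t q.2) q.1 ^ 2) + c2 * g q.1 q.2 ^ 2 +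
        c3 * (exp (-lam * q.1) * deriv (z q.1) q.2 ^ 2))
        (Ioo 0 T ×ˢ Ioo l r) := j1.add (i2.const_mul c3)
    refine ⟨j2.add (i0.const_mul c4), ?_⟩
    rw [integral_add j2 (i0.const_mul c4), integral_add j1 (i2.const_mul c3),
      integral_add (i1.const_mul c1) (hg.const_mul c2), integral_const_mul, integral_const_mul,
      integral_const_mul, integral_const_mul]
  constructor
  · obtain ⟨ci, ce⟩ := comb (-(α / 2)) (3 / (2 * α)) (3 / (2 * α) * B ^ 2)
      (3 / (2 * α) * (B + K) ^ 2)
    have hLi : IntegrableOn (fun q : ℝ × ℝ => exp (-lam * q.1) * (-deriv (deriv (z q.1)) q.2) *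
        deriv (fun t => z t q.2) q.1) (Ioo 0 T ×ˢ Ioo l r) := by
      have hw := ihe_wmem _ (fun q : ℝ × ℝ => exp (-lam * q.1)) _ (by fun_prop) (by
        refine (ae_restrict_iff' hS).2 (Filter.Eventually.of_forall fun q hq => ?_)
        rw [abs_of_pos (exp_pos _), Real.exp_le_one_iff]
        have := hq.1.1
        nlinarith) L3.neg
      exact hw.integrable_mul L1
    have hmono := setIntegral_mono_on hLi ci hS (fun q hq => by
      have he := heq q.1 hq.1 q.2 hq.2
      have hw0 := exp_pos (-lam * q.1)
      have hw1 : exp (-lam * q.1) ≤ 1 := by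
        rw [Real.exp_le_one_iff]; have := hq.1.1; nlinarith
      have hρ := hρpos q.1 q.2
      have hb' := hbb q.1 q.2
      have hc' := hcc q.1 q.2
      generalize exp (-lam * q.1) = w at *
      generalize deriv (fun t => z t q.2) q.1 = zt at *
      generalize deriv (deriv (z q.1)) q.2 = zxx at *
      generalize deriv (z q.1) q.2 = zx at *
      generalize z q.1 q.2 = u at *
      generalize g q.1 q.2 = gg at *
      generalize bb q.1 q.2 = bq at *
      generalize cc q.1 q.2 = cq at *
      generalize ρ q.1 q.2 = rq at *
      have hb2 : (bq * zx) ^ 2 ≤ B ^ 2 * zx ^ 2 := by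
        rw [mul_pow]; exact mul_le_mul_of_nonneg_right (sq_le_sq' (abs_le.1 hb').1 (abs_le.1 hb').2) (sq_nonneg _)
      have hc2 : ((cq + K) * u) ^ 2 ≤ (B + K) ^ 2 * u ^ 2 := by
        rw [mul_pow]
        refine mul_le_mul_of_nonneg_right (sq_le_sq' ?_ ?_) (sq_nonneg _)
        · linarith [(abs_le.1 hc').1]
        · linarith [(abs_le.1 hc').2]
      set X := gg - bq * zx - (cq + K) * u with hX
      have hXz : -zxx = X - rq * zt := by rw [hX]; linarith
      have hX2 : X ^ 2 ≤ 3 * (gg ^ 2 + B ^ 2 * zx ^ 2 + (B + K) ^ 2 * u ^ 2) := by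
        have : X ^ 2 ≤ 3 * (gg ^ 2 + (bq * zx) ^ 2 + ((cq + K) * u) ^ 2) := by
          rw [hX]
          nlinarith [sq_nonneg (gg + bq * zx), sq_nonneg (gg + (cq + K) * u),
            sq_nonneg (bq * zx - (cq + K) * u)]
        linarith
      have hXzt : X * zt ≤ α / 2 * zt ^ 2 + 1 / (2 * α) * X ^ 2 := by
        have : 0 ≤ 1 / (2 * α) * (α * zt - X) ^ 2 := by positivity
        have e : 1 / (2 * α) * (α * zt - X) ^ 2 =
          α / 2 * zt ^ 2 + 1 / (2 * α) * X ^ 2 - X * zt := by field_simp; ring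
        linarith
      have hmain : (-zxx) * zt ≤ -(α / 2) * zt ^ 2 +
          3 / (2 * α) * (gg ^ 2 + B ^ 2 * zx ^ 2 + (B + K) ^ 2 * u ^ 2) := by
        rw [hXz]
        have h5 : 1 / (2 * α) * X ^ 2 ≤ 3 / (2 * α) * (gg ^ 2 + B ^ 2 * zx ^ 2 + (B + K) ^ 2 * u ^ 2) := by
          have := mul_le_mul_of_nonneg_left hX2 (by positivity : 0 ≤ 1 / (2 * α))
          refine this.trans (le_of_eq ?_); ring
        have h6 : α * zt ^ 2 ≤ rq * zt ^ 2 := mul_le_mul_of_nonneg_right hρ (sq_nonneg _)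
        have h7 : (X - rq * zt) * zt = X * zt - rq * zt ^ 2 := by ring
        rw [h7]; linarith
      have hm2 := mul_le_mul_of_nonneg_left hmain hw0.le
      have hgg : 3 / (2 * α) * (w * gg ^ 2) ≤ 3 / (2 * α) * gg ^ 2 :=
        mul_le_mul_of_nonneg_left (mul_le_of_le_one_left (sq_nonneg _) hw1) (by positivity)
      calc w * -zxx * zt = w * (-zxx * zt) := by ring
        _ ≤ _ := hm2
        _ = -(α / 2) * (w * zt ^ 2) + 3 / (2 * α) * (w * gg ^ 2) +
            3 / (2 * α) * B ^ 2 * (w * zx ^ 2) + 3 / (2 * α) * (B + K) ^ 2 * (w * u ^ 2) := by ring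
        _ ≤ _ := by linarith)
    rw [ce] at hmono
    have := mul_le_mul_of_nonneg_left hz2 (by positivity : 0 ≤ 3 / (2 * α) * (B + K) ^ 2)
    refine hmono.trans ?_
    linarith
  · obtain ⟨ci, ce⟩ := comb (exp (lam * T) * (1 + 4 * R ^ 2)) 4 (exp (lam * T) * (1 + 4 * B ^ 2))
      (exp (lam * T) * (1 + 4 * (B + K) ^ 2))
    have hmono := setIntegral_mono_on hint ci hS (fun q hq => by
      have he := heq q.1 hq.1 q.2 hq.2
      have hw1 : 1 ≤ exp (lam * T) * exp (-lam * q.1) := by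
        rw [← Real.exp_add]; refine Real.one_le_exp ?_; have := hq.1.2; nlinarith
      have hρ := hρpos q.1 q.2
      have hρ2 := hρR q.1 ⟨hq.1.1.le, hq.1.2.le⟩ q.2 ⟨hq.2.1.le, hq.2.2.le⟩
      have hb' := hbb q.1 q.2
      have hc' := hcc q.1 q.2
      generalize exp (-lam * q.1) = w at *
      generalize exp (lam * T) = v at *
      generalize deriv (fun t => z t q.2) q.1 = zt at *
      generalize deriv (deriv (z q.1)) q.2 = zxx at *
      generalize deriv (z q.1) q.2 = zx at *
      generalize z q.1 q.2 = u at *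
      generalize g q.1 q.2 = gg at *
      generalize bb q.1 q.2 = bq at *
      generalize cc q.1 q.2 = cq at *
      generalize ρ q.1 q.2 = rq at *
      have hb2 : (bq * zx) ^ 2 ≤ B ^ 2 * zx ^ 2 := by
        rw [mul_pow]; exact mul_le_mul_of_nonneg_right (sq_le_sq' (abs_le.1 hb').1 (abs_le.1 hb').2) (sq_nonneg _)
      have hc2 : ((cq + K) * u) ^ 2 ≤ (B + K) ^ 2 * u ^ 2 := by
        rw [mul_pow]
        refine mul_le_mul_of_nonneg_right (sq_le_sq' ?_ ?_) (sq_nonneg _)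
        · linarith [(abs_le.1 hc').1]
        · linarith [(abs_le.1 hc').2]
      have hr2 : (rq * zt) ^ 2 ≤ R ^ 2 * zt ^ 2 := by
        rw [mul_pow]
        exact mul_le_mul_of_nonneg_right (sq_le_sq' (by linarith) hρ2) (sq_nonneg _)
      have hx : zxx = rq * zt + bq * zx + (cq + K) * u - gg := by linarith
      have hx2 : zxx ^ 2 ≤ 4 * ((rq * zt) ^ 2 + (bq * zx) ^ 2 + ((cq + K) * u) ^ 2 + gg ^ 2) := by
        rw [hx]
        generalize rq * zt = q1
        generalize bq * zx = q2
        generalize (cq + K) * u = q3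
        nlinarith [sq_nonneg (q1 - q2), sq_nonneg (q1 - q3), sq_nonneg (q1 + gg),
          sq_nonneg (q2 - q3), sq_nonneg (q2 + gg), sq_nonneg (q3 + gg)]
      have hn : 0 ≤ (1 + 4 * R ^ 2) * zt ^ 2 + (1 + 4 * B ^ 2) * zx ^ 2 +
        (1 + 4 * (B + K) ^ 2) * u ^ 2 := by positivity
      have hn2 := mul_le_mul_of_nonneg_right hw1 hn
      calc u ^ 2 + zt ^ 2 + zx ^ 2 + zxx ^ 2 ≤ 1 * ((1 + 4 * R ^ 2) * zt ^ 2 +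
            (1 + 4 * B ^ 2) * zx ^ 2 + (1 + 4 * (B + K) ^ 2) * u ^ 2) + 4 * gg ^ 2 := by linarith
        _ ≤ v * w * ((1 + 4 * R ^ 2) * zt ^ 2 +
            (1 + 4 * B ^ 2) * zx ^ 2 + (1 + 4 * (B + K) ^ 2) * u ^ 2) + 4 * gg ^ 2 := by linarith
        _ = _ := by ring)
    rw [ce] at hmono
    have := mul_le_mul_of_nonneg_left hz2 (by positivity : 0 ≤ exp (lam * T) * (1 + 4 * (B + K) ^ 2))
    refine hmono.trans ?_
    linarith

lemma ihe_iface (T lam M K b : ℝ) (hlam : 0 < lam) (hM : 0 < M) 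
    (u G p : ℝ → ℝ) (E : ℝ → ℝ) (hu : Differentiable ℝ u)
    (hint : IntegrableOn (fun t => u t ^ 2 + deriv u t ^ 2) (Ioo 0 T) volume)
    (hp : IntegrableOn (fun t => p t ^ 2) (Ioo 0 T) volume)
    (hGm : Measurable G)
    (hGe : ∀ t ∈ Icc 0 T, G t = M * deriv u t + M * K * u t - p t)
    (hE : IntegrableOn (fun t => exp (-lam * t) * E t) (Ioo 0 T))
    (huE : ∀ t ∈ Ioo 0 T, u t ^ 2 ≤ b * E t) :
    MemLp (deriv u) 2 (volume.restrict (Ioo 0 T)) ∧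
    MemLp G 2 (volume.restrict (Ioo 0 T)) ∧
    (∫ t in Ioo 0 T, exp (-lam * t) * (-G t) * deriv u t) ≤
      -(M / 2) * (∫ t in Ioo 0 T, exp (-lam * t) * deriv u t ^ 2) +
      1 / M * (∫ t in Ioo 0 T, p t ^ 2) +
      M * K ^ 2 * b * (∫ t in Ioo 0 T, exp (-lam * t) * E t) ∧
    (∫ t in Ioo 0 T, (u t ^ 2 + deriv u t ^ 2)) ≤
      exp (lam * T) * (∫ t in Ioo 0 T, exp (-lam * t) * deriv u t ^ 2) +
      exp (lam * T) * b * (∫ t in Ioo 0 T, exp (-lam * t) * E t) := by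
  have md : Measurable (deriv u) := measurable_deriv u
  have mu : Measurable u := hu.continuous.measurable
  have d2 : IntegrableOn (fun t => deriv u t ^ 2) (Ioo 0 T) :=
    hint.mono' (md.pow_const 2).aestronglyMeasurable (Filter.Eventually.of_forall fun t => by
      rw [Real.norm_of_nonneg (sq_nonneg _)]; linarith [sq_nonneg (u t)])
  have Ld : MemLp (deriv u) 2 (volume.restrict (Ioo 0 T)) :=
    (memLp_two_iff_integrable_sq md.aestronglyMeasurable).2 d2
  have LG : MemLp G 2 (volume.restrict (Ioo 0 T)) := by
    rw [memLp_two_iff_integrable_sq hGm.aestronglyMeasurable]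
    have hdom : IntegrableOn (fun t => (3 * (M ^ 2 + (M * K) ^ 2)) * (u t ^ 2 + deriv u t ^ 2) +
      3 * p t ^ 2) (Ioo 0 T) := (hint.const_mul _).add (hp.const_mul _)
    refine hdom.mono' (hGm.pow_const 2).aestronglyMeasurable
      ((ae_restrict_iff' measurableSet_Ioo).2 (Filter.Eventually.of_forall fun t ht => ?_))
    rw [Real.norm_of_nonneg (sq_nonneg _), hGe t ⟨ht.1.le, ht.2.le⟩]
    generalize deriv u t = v
    generalize u t = y
    generalize p t = s
    have h1 : (M * v + M * K * y - s) ^ 2 ≤ 3 * ((M * v) ^ 2 + (M * K * y) ^ 2 + s ^ 2) := by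
      nlinarith [sq_nonneg (M * v - M * K * y), sq_nonneg (M * v + s), sq_nonneg (M * K * y + s)]
    have h2 : 0 ≤ (M * y) ^ 2 + (M * K * v) ^ 2 := by positivity
    nlinarith
  have wmem : ∀ f : ℝ → ℝ, MemLp f 2 (volume.restrict (Ioo 0 T)) →
      MemLp (fun t => exp (-lam * t) * f t) 2 (volume.restrict (Ioo 0 T)) := fun f hf =>
    ihe_wmem _ (fun t : ℝ => exp (-lam * t)) _ (by fun_prop) (by
      refine (ae_restrict_iff' measurableSet_Ioo).2 (Filter.Eventually.of_forall fun t ht => ?_)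
      rw [abs_of_pos (exp_pos _), Real.exp_le_one_iff]
      have := ht.1
      nlinarith) hf
  have wd2 : IntegrableOn (fun t => exp (-lam * t) * deriv u t ^ 2) (Ioo 0 T) := by
    refine ((wmem _ Ld).integrable_mul Ld).congr (Filter.Eventually.of_forall fun t => ?_)
    simp only [Pi.mul_apply]; ring
  have wGd : IntegrableOn (fun t => exp (-lam * t) * (-G t) * deriv u t) (Ioo 0 T) :=
    (wmem _ LG.neg).integrable_mul Ld
  refine ⟨Ld, LG, ?_, ?_⟩
  · have j1 : IntegrableOn (fun t => -(M / 2) * (exp (-lam * t) * deriv u t ^ 2) +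
      1 / M * p t ^ 2) (Ioo 0 T) := (wd2.const_mul _).add (hp.const_mul _)
    have j2 : IntegrableOn (fun t => -(M / 2) * (exp (-lam * t) * deriv u t ^ 2) +
      1 / M * p t ^ 2 + M * K ^ 2 * b * (exp (-lam * t) * E t)) (Ioo 0 T) :=
      j1.add (hE.const_mul _)
    have hm := setIntegral_mono_on wGd j2 measurableSet_Ioo (fun t ht => by
      have hw0 := exp_pos (-lam * t)
      have hw1 : exp (-lam * t) ≤ 1 := by
        rw [Real.exp_le_one_iff]; have := ht.1; nlinarith
      have hue := huE t ht
      rw [hGe t ⟨ht.1.le, ht.2.le⟩]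
      generalize exp (-lam * t) = w at *
      generalize deriv u t = v at *
      generalize u t = y at *
      generalize p t = s at *
      generalize E t = e at *
      have h1 : 0 ≤ M * (v / 2 + K * y) ^ 2 := by positivity
      have h2 : 0 ≤ 1 / M * (M / 2 * v - s) ^ 2 := by positivity
      have h2' : 1 / M * (M / 2 * v - s) ^ 2 = M / 4 * v ^ 2 - v * s + 1 / M * s ^ 2 := by
        field_simp; ring
      have h3 : M * K ^ 2 * y ^ 2 ≤ M * K ^ 2 * (b * e) :=
        mul_le_mul_of_nonneg_left hue (by positivity)
      have h4 : -(M * v + M * K * y - s) * v ≤ -(M / 2) * v ^ 2 + 1 / M * s ^ 2 +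
        M * K ^ 2 * (b * e) := by nlinarith
      have h5 := mul_le_mul_of_nonneg_left h4 hw0.le
      have h6 : 1 / M * (w * s ^ 2) ≤ 1 / M * s ^ 2 :=
        mul_le_mul_of_nonneg_left (mul_le_of_le_one_left (sq_nonneg _) hw1) (by positivity)
      calc w * -(M * v + M * K * y - s) * v = w * (-(M * v + M * K * y - s) * v) := by ring
        _ ≤ _ := h5
        _ = -(M / 2) * (w * v ^ 2) + 1 / M * (w * s ^ 2) + M * K ^ 2 * b * (w * e) := by ring
        _ ≤ _ := by linarith)
    rw [integral_add j1 (hE.const_mul _), integral_add (wd2.const_mul _) (hp.const_mul _),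
      integral_const_mul, integral_const_mul, integral_const_mul] at hm
    exact hm
  · have j2 : IntegrableOn (fun t => exp (lam * T) * (exp (-lam * t) * deriv u t ^ 2) +
       exp (lam * T) * b * (exp (-lam * t) * E t)) (Ioo 0 T) :=
      (wd2.const_mul _).add (hE.const_mul _)
    have hm := setIntegral_mono_on hint j2 measurableSet_Ioo (fun t ht => by
      have hw1 : 1 ≤ exp (lam * T) * exp (-lam * t) := by
        rw [← Real.exp_add]; refine Real.one_le_exp ?_; have := ht.2; nlinarith
      have hue := huE t ht
      have hn : 0 ≤ deriv u t ^ 2 + b * E t := by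
        linarith [sq_nonneg (u t), sq_nonneg (deriv u t)]
      have := mul_le_mul_of_nonneg_right hw1 hn
      nlinarith)
    rw [integral_add (wd2.const_mul _) (hE.const_mul _), integral_const_mul,
      integral_const_mul] at hm
    exact hm

lemma ihe_sqrt (X C P G1 G2 : ℝ) (hC : 0 ≤ C) (hP : 0 ≤ P) (h1 : 0 ≤ G1) (h2 : 0 ≤ G2)
    (h : X ≤ C * (P + G1 + G2)) : √X ≤ √C * (√P + √G1 + √G2) := by
  have : √(P + G1 + G2) ≤ √P + √G1 + √G2 := by
    rw [Real.sqrt_le_left (by positivity)]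
    have a1 := Real.sq_sqrt hP
    have a2 := Real.sq_sqrt h1
    have a3 := Real.sq_sqrt h2
    have b1 := Real.sqrt_nonneg P
    have b2 := Real.sqrt_nonneg G1
    have b3 := Real.sqrt_nonneg G2
    nlinarith [mul_nonneg b1 b2, mul_nonneg b1 b3, mul_nonneg b2 b3]
  calc √X ≤ √(C * (P + G1 + G2)) := Real.sqrt_le_sqrt h
    _ = √C * √(P + G1 + G2) := Real.sqrt_mul hC _
    _ ≤ _ := mul_le_mul_of_nonneg_left this (Real.sqrt_nonneg _)



set_option maxHeartbeats 1000000 in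
/-- Energy estimate for the interface heat system with a point-mass dynamic
transmission condition: the `H^{1,2}` norms of `z₁, z₂` and the `H¹` norm of the
interface trace are controlled by the data `g₁, g₂, p`. -/
theorem interface_heat_energy_estimate
    (a b T M K α : ℝ) (ha : a < 0) (hb : 0 < b) (hT : 0 < T)
    (hM : 0 < M) (hK : 0 < K) (hα : 0 < α)
    (ρ b₁ b₂ c₁ c₂ : ℝ → ℝ → ℝ)
    (hρcont : Continuous fun q : ℝ × ℝ => ρ q.1 q.2)
    (hρpos : ∀ x₀ x₁, α ≤ ρ x₀ x₁)
    (Bcoef : ℝ)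
    (hbnd : ∀ x₀ x₁, |b₁ x₀ x₁| ≤ Bcoef ∧ |b₂ x₀ x₁| ≤ Bcoef ∧
      |c₁ x₀ x₁| ≤ Bcoef ∧ |c₂ x₀ x₁| ≤ Bcoef) :
    ∃ C > (0 : ℝ),
      ∀ z₁ z₂ g₁ g₂ : ℝ → ℝ → ℝ, ∀ p : ℝ → ℝ,
      -- pointwise regularity
      (∀ x₁, Differentiable ℝ (fun t => z₁ t x₁)) →
      (∀ x₁, Differentiable ℝ (fun t => z₂ t x₁)) →
      (∀ x₀, ContDiff ℝ 2 (z₁ x₀)) → (∀ x₀, ContDiff ℝ 2 (z₂ x₀)) →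
      -- H^{1,2} integrability on Q₊ = (0,T) × (0,b)
      IntegrableOn (fun q : ℝ × ℝ => z₁ q.1 q.2 ^ 2 +
        (deriv (fun t => z₁ t q.2) q.1) ^ 2 + (deriv (z₁ q.1) q.2) ^ 2 +
        (deriv (deriv (z₁ q.1)) q.2) ^ 2) (Ioo 0 T ×ˢ Ioo 0 b) volume →
      -- H^{1,2} integrability on Q₋ = (0,T) × (a,0)
      IntegrableOn (fun q : ℝ × ℝ => z₂ q.1 q.2 ^ 2 +
        (deriv (fun t => z₂ t q.2) q.1) ^ 2 + (deriv (z₂ q.1) q.2) ^ 2 +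
        (deriv (deriv (z₂ q.1)) q.2) ^ 2) (Ioo 0 T ×ˢ Ioo a 0) volume →
      -- trace and data integrability
      IntegrableOn (fun t => z₁ t 0 ^ 2 + (deriv (fun τ => z₁ τ 0) t) ^ 2)
        (Ioo 0 T) volume →
      IntegrableOn (fun q : ℝ × ℝ => g₁ q.1 q.2 ^ 2) (Ioo 0 T ×ˢ Ioo 0 b) volume →
      IntegrableOn (fun q : ℝ × ℝ => g₂ q.1 q.2 ^ 2) (Ioo 0 T ×ˢ Ioo a 0) volume →
      IntegrableOn (fun t => p t ^ 2) (Ioo 0 T) volume →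
      -- the equations
      (∀ x₀ ∈ Ioo 0 T, ∀ x₁ ∈ Ioo 0 b,
        ρ x₀ x₁ * deriv (fun t => z₁ t x₁) x₀ - deriv (deriv (z₁ x₀)) x₁ +
          b₁ x₀ x₁ * deriv (z₁ x₀) x₁ + (c₁ x₀ x₁ + K) * z₁ x₀ x₁ = g₁ x₀ x₁) →
      (∀ x₀ ∈ Ioo 0 T, ∀ x₁ ∈ Ioo a 0,
        ρ x₀ x₁ * deriv (fun t => z₂ t x₁) x₀ - deriv (deriv (z₂ x₀)) x₁ +
          b₂ x₀ x₁ * deriv (z₂ x₀) x₁ + (c₂ x₀ x₁ + K) * z₂ x₀ x₁ = g₂ x₀ x₁) →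
      -- initial, boundary and interface conditions
      (∀ x₁, z₁ 0 x₁ = 0) → (∀ x₁, z₂ 0 x₁ = 0) →
      (∀ x₀ ∈ Icc 0 T, z₁ x₀ b = 0) → (∀ x₀ ∈ Icc 0 T, z₂ x₀ a = 0) →
      (∀ x₀ ∈ Icc 0 T, z₁ x₀ 0 = z₂ x₀ 0) →
      (∀ x₀ ∈ Icc 0 T,
        deriv (z₁ x₀) 0 - deriv (z₂ x₀) 0 =
          M * deriv (fun t => z₁ t 0) x₀ + M * K * z₁ x₀ 0 - p x₀) →
      -- conclusion: the energy estimate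
      Real.sqrt (∫ q in Ioo 0 T ×ˢ Ioo 0 b, (z₁ q.1 q.2 ^ 2 +
          (deriv (fun t => z₁ t q.2) q.1) ^ 2 + (deriv (z₁ q.1) q.2) ^ 2 +
          (deriv (deriv (z₁ q.1)) q.2) ^ 2)) +
        Real.sqrt (∫ q in Ioo 0 T ×ˢ Ioo a 0, (z₂ q.1 q.2 ^ 2 +
          (deriv (fun t => z₂ t q.2) q.1) ^ 2 + (deriv (z₂ q.1) q.2) ^ 2 +
          (deriv (deriv (z₂ q.1)) q.2) ^ 2)) +
        Real.sqrt (∫ t in Ioo 0 T, (z₁ t 0 ^ 2 + (deriv (fun τ => z₁ τ 0) t) ^ 2)) ≤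
      C * (Real.sqrt (∫ t in Ioo 0 T, p t ^ 2) +
        Real.sqrt (∫ q in Ioo 0 T ×ˢ Ioo 0 b, g₁ q.1 q.2 ^ 2) +
        Real.sqrt (∫ q in Ioo 0 T ×ˢ Ioo a 0, g₂ q.1 q.2 ^ 2)) := by
  -- bounds and constants
  have hB : 0 ≤ Bcoef := (abs_nonneg _).trans (hbnd 0 0).1
  obtain ⟨R, hR⟩ : ∃ R, ∀ t ∈ Icc 0 T, ∀ x ∈ Icc a b, ρ t x ≤ R := by
    obtain ⟨R, hR⟩ := ((isCompact_Icc (a := (0:ℝ)) (b := T)).prod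
      (isCompact_Icc (a := a) (b := b))).bddAbove_image hρcont.continuousOn
    exact ⟨R, fun t ht x hx => hR ⟨(t, x), ⟨ht, hx⟩, rfl⟩⟩
  obtain ⟨κ, hκ⟩ : ∃ κ, κ = 3 / (2 * α) := ⟨_, rfl⟩
  have hκ0 : 0 < κ := by rw [hκ]; positivity
  obtain ⟨N1, hN1⟩ : ∃ N, N = κ * (Bcoef ^ 2 + (Bcoef + K) ^ 2 * (b - 0) ^ 2) := ⟨_, rfl⟩
  obtain ⟨N2, hN2⟩ : ∃ N, N = κ * (Bcoef ^ 2 + (Bcoef + K) ^ 2 * (0 - a) ^ 2) := ⟨_, rfl⟩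
  obtain ⟨N3, hN3⟩ : ∃ N, N = M * K ^ 2 * b := ⟨_, rfl⟩
  have hN10 : 0 ≤ N1 := by rw [hN1]; positivity
  have hN20 : 0 ≤ N2 := by rw [hN2]; positivity
  have hN30 : 0 ≤ N3 := by rw [hN3]; positivity
  obtain ⟨lam, hlamdef⟩ : ∃ l, l = 4 * (N1 + N2 + N3 + 1) := ⟨_, rfl⟩
  have hlam : 0 < lam := by rw [hlamdef]; positivity
  obtain ⟨c0, hc0⟩ : ∃ c, c = 1 / M + κ := ⟨_, rfl⟩
  have hc00 : 0 < c0 := by rw [hc0]; positivity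
  obtain ⟨k1, hk1⟩ : ∃ c, c = exp (lam * T) * (1 + 4 * R ^ 2) := ⟨_, rfl⟩
  obtain ⟨k2, hk2⟩ : ∃ c, c = exp (lam * T) * ((1 + 4 * Bcoef ^ 2) +
    (1 + 4 * (Bcoef + K) ^ 2) * (b - 0) ^ 2) := ⟨_, rfl⟩
  obtain ⟨k3, hk3⟩ : ∃ c, c = exp (lam * T) * ((1 + 4 * Bcoef ^ 2) +
    (1 + 4 * (Bcoef + K) ^ 2) * (0 - a) ^ 2) := ⟨_, rfl⟩
  obtain ⟨k4, hk4⟩ : ∃ c, c = exp (lam * T) * b := ⟨_, rfl⟩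
  obtain ⟨k5, hk5⟩ : ∃ c, c = exp (lam * T) := ⟨_, rfl⟩
  have hk10 : 0 ≤ k1 := by rw [hk1]; positivity
  have hk20 : 0 ≤ k2 := by rw [hk2]; positivity
  have hk30 : 0 ≤ k3 := by rw [hk3]; positivity
  have hk40 : 0 ≤ k4 := by rw [hk4]; positivity
  have hk50 : 0 ≤ k5 := by rw [hk5]; positivity
  set C1 := k1 * (2 / α * c0) + 4 + k2 * c0 with hC1
  set C2 := k1 * (2 / α * c0) + 4 + k3 * c0 with hC2
  set C3 := k5 * (2 / M * c0) + k4 * c0 with hC3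
  have hC10 : 0 ≤ C1 := by positivity
  have hC20 : 0 ≤ C2 := by positivity
  have hC30 : 0 ≤ C3 := by positivity
  refine ⟨√C1 + √C2 + √C3 + 1, by positivity, ?_⟩
  intro z₁ z₂ g₁ g₂ p h11 h12 h21 h22 hint1 hint2 htr hg1 hg2 hp heq1 heq2 hz10 hz20 hz1b hz2a hif
    hdyn
  obtain ⟨L10, L11, L12, L13⟩ := ihe_comp _ z₁ h11 h21 hint1
  obtain ⟨-, wE1, -⟩ := ihe_wE 0 b T lam hlam (fun t x => deriv (z₁ t) x) L12
  have mzx : ∀ z : ℝ → ℝ → ℝ, (∀ x, Differentiable ℝ (fun t => z t x)) →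
      (∀ t, ContDiff ℝ 2 (z t)) → Measurable fun t => deriv (z t) 0 := fun z h1 h2 =>
    (ihe_meas_snd z (ihe_meas_joint z h1 h2) (fun t => (h2 t).differentiable (by norm_num))).comp
      (f := fun t : ℝ => (t, (0 : ℝ))) (by fun_prop)
  obtain ⟨Ld, LG, I1, I2⟩ := ihe_iface T lam M K b hlam hM (fun t => z₁ t 0)
    (fun t => deriv (z₁ t) 0 - deriv (z₂ t) 0) p (fun t => ∫ x in Ioo 0 b, deriv (z₁ t) x ^ 2)
    (h11 0) htr hp ((mzx z₁ h11 h21).sub (mzx z₂ h12 h22)) hdyn wE1 (fun t ht => by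
      have := ihe_poincare 0 b 0 b ⟨le_rfl, hb.le⟩ ⟨hb.le, le_rfl⟩ (z₁ t) (h21 t)
      rwa [hz1b t ⟨ht.1.le, ht.2.le⟩, sub_zero, sub_zero] at this)
  have hen := ihe_energy a b T lam ha hb hlam z₁ z₂ h11 h21 h12 h22 hint1 hint2 hz10 hz20 hz1b hz2a
    hif Ld LG
  obtain ⟨A1, A1'⟩ := ihe_side 0 b T lam K α Bcoef R hlam hb hα hK ρ b₁ c₁ z₁ g₁ hρpos
    (fun t ht x hx => hR t ht x ⟨ha.le.trans hx.1, hx.2⟩) (fun t x => (hbnd t x).1)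
    (fun t x => (hbnd t x).2.2.1) h11 h21 hint1 hg1 heq1 b ⟨hb.le, le_rfl⟩ hz1b
  obtain ⟨A2, A2'⟩ := ihe_side a 0 T lam K α Bcoef R hlam ha hα hK ρ b₂ c₂ z₂ g₂ hρpos
    (fun t ht x hx => hR t ht x ⟨hx.1, hx.2.trans hb.le⟩) (fun t x => (hbnd t x).2.1)
    (fun t x => (hbnd t x).2.2.2) h12 h22 hint2 hg2 heq2 a ⟨le_rfl, ha.le⟩ hz2a
  rw [← hκ, ← hN1] at A1
  rw [← hκ, ← hN2] at A2
  rw [← hN3] at I1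
  rw [← hk1, ← hk2] at A1'
  rw [← hk1, ← hk3] at A2'
  rw [← hk4, ← hk5] at I2
  have Y1n : 0 ≤ ∫ t in Ioo 0 T, exp (-lam * t) * ∫ x in Ioo 0 b, deriv (z₁ t) x ^ 2 :=
    integral_nonneg fun t => mul_nonneg (exp_pos _).le (integral_nonneg fun _ => sq_nonneg _)
  have Y2n : 0 ≤ ∫ t in Ioo 0 T, exp (-lam * t) * ∫ x in Ioo a 0, deriv (z₂ t) x ^ 2 :=
    integral_nonneg fun t => mul_nonneg (exp_pos _).le (integral_nonneg fun _ => sq_nonneg _)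
  have Zn : 0 ≤ ∫ t in Ioo 0 T, exp (-lam * t) * deriv (fun t => z₁ t 0) t ^ 2 :=
    integral_nonneg fun t => mul_nonneg (exp_pos _).le (sq_nonneg _)
  have A1n : 0 ≤ ∫ q in Ioo 0 T ×ˢ Ioo 0 b, exp (-lam * q.1) * deriv (fun t => z₁ t q.2) q.1 ^ 2 :=
    integral_nonneg fun t => mul_nonneg (exp_pos _).le (sq_nonneg _)
  have A2n : 0 ≤ ∫ q in Ioo 0 T ×ˢ Ioo a 0, exp (-lam * q.1) * deriv (fun t => z₂ t q.2) q.1 ^ 2 :=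
    integral_nonneg fun t => mul_nonneg (exp_pos _).le (sq_nonneg _)
  have Pn : 0 ≤ ∫ t in Ioo 0 T, p t ^ 2 := integral_nonneg fun t => sq_nonneg _
  have G1n : 0 ≤ ∫ q in Ioo 0 T ×ˢ Ioo 0 b, g₁ q.1 q.2 ^ 2 := integral_nonneg fun t => sq_nonneg _
  have G2n : 0 ≤ ∫ q in Ioo 0 T ×ˢ Ioo a 0, g₂ q.1 q.2 ^ 2 := integral_nonneg fun t => sq_nonneg _
  have hfin : ∀ X1 X2 X3 Y1 Y2 Z A B P G1 G2 J1 J2 J3 : ℝ, 0 ≤ Y1 → 0 ≤ Y2 → 0 ≤ Z → 0 ≤ A →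
      0 ≤ B → 0 ≤ P → 0 ≤ G1 → 0 ≤ G2 → lam / 4 * (Y1 + Y2) ≤ J1 + J2 + J3 →
      J1 ≤ -(M / 2) * Z + 1 / M * P + N3 * Y1 →
      J2 ≤ -(α / 2) * A + κ * G1 + N1 * Y1 → J3 ≤ -(α / 2) * B + κ * G2 + N2 * Y2 →
      X1 ≤ k1 * A + 4 * G1 + k2 * Y1 → X2 ≤ k1 * B + 4 * G2 + k3 * Y2 → X3 ≤ k5 * Z + k4 * Y1 →
      √X1 + √X2 + √X3 ≤ (√C1 + √C2 + √C3 + 1) * (√P + √G1 + √G2) := by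
    intro X1 X2 X3 Y1 Y2 Z A B P G1 G2 J1 J2 J3 hY1 hY2 hZ hA hB' hP hG1 hG2 h1 h2 h3 h4 h5 h6 h7
    have hM1 : 0 < 1 / M := by positivity
    have main : Y1 + Y2 + α / 2 * A + α / 2 * B + M / 2 * Z ≤ c0 * (P + G1 + G2) := by
      rw [hlamdef] at h1
      rw [hc0]
      have q1 := mul_nonneg hN10 hY2
      have q2 := mul_nonneg hN20 hY1
      have q3 := mul_nonneg hN30 hY2
      have q4 := mul_nonneg hκ0.le hP
      have q5 := mul_nonneg hM1.le hG1
      have q6 := mul_nonneg hM1.le hG2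
      linarith
    have hαA : 0 ≤ α / 2 * A := by positivity
    have hαB : 0 ≤ α / 2 * B := by positivity
    have hMZ : 0 ≤ M / 2 * Z := by positivity
    set D := P + G1 + G2 with hD
    have eA : A ≤ 2 / α * c0 * D := by
      have : α / 2 * A ≤ c0 * D := by linarith
      have := mul_le_mul_of_nonneg_left this (by positivity : 0 ≤ 2 / α)
      calc A = 2 / α * (α / 2 * A) := by field_simp
        _ ≤ _ := this
        _ = _ := by ring
    have eB : B ≤ 2 / α * c0 * D := by
      have : α / 2 * B ≤ c0 * D := by linarith
      have := mul_le_mul_of_nonneg_left this (by positivity : 0 ≤ 2 / α)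
      calc B = 2 / α * (α / 2 * B) := by field_simp
        _ ≤ _ := this
        _ = _ := by ring
    have eZ : Z ≤ 2 / M * c0 * D := by
      have : M / 2 * Z ≤ c0 * D := by linarith
      have := mul_le_mul_of_nonneg_left this (by positivity : 0 ≤ 2 / M)
      calc Z = 2 / M * (M / 2 * Z) := by field_simp
        _ ≤ _ := this
        _ = _ := by ring
    have eY1 : Y1 ≤ c0 * D := by linarith
    have eY2 : Y2 ≤ c0 * D := by linarith
    have x1 : X1 ≤ C1 * D := by
      have r1 := mul_le_mul_of_nonneg_left eA hk10
      have r2 := mul_le_mul_of_nonneg_left eY1 hk20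
      rw [hC1]; linarith
    have x2 : X2 ≤ C2 * D := by
      have r1 := mul_le_mul_of_nonneg_left eB hk10
      have r2 := mul_le_mul_of_nonneg_left eY2 hk30
      rw [hC2]; linarith
    have x3 : X3 ≤ C3 * D := by
      have r1 := mul_le_mul_of_nonneg_left eZ hk50
      have r2 := mul_le_mul_of_nonneg_left eY1 hk40
      rw [hC3]; linarith
    have s1 := ihe_sqrt X1 C1 P G1 G2 hC10 hP hG1 hG2 x1
    have s2 := ihe_sqrt X2 C2 P G1 G2 hC20 hP hG1 hG2 x2
    have s3 := ihe_sqrt X3 C3 P G1 G2 hC30 hP hG1 hG2 x3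
    have s4 : 0 ≤ √P + √G1 + √G2 := by positivity
    linarith
  exact hfin _ _ _ _ _ _ _ _ _ _ _ _ _ _ Y1n Y2n Zn A1n A2n Pn G1n G2n hen I1 A1 A2 A1' A2' I2
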